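/- arXiv:2512.12805 — 3 statements merged into one kernel-verified Lean document; each statement's English description precedes it below -/
import Mathlib

section
/- Let (χ, μ) be a probability space, δ ∈ (0, 1], and p: χ × χ → [0, 1/δ] a measurable function; for k ≥ 2 define the k-step kernel p^{(k)}(x,y) = ∫_{χ^{k−1}} p(x,z₁)·p(z₁,z₂)⋯p(z_{k−1},y) dμ(z₁)⋯dμ(z_{k−1}). Let n ≥ 2k, let X₁, …, Xₙ be i.i.d. samples from μ, and define the n×n matrix Π by Π_{ij} = p(Xᵢ, Xⱼ) for i ≠ j and Π_{ii} = 0. Then for every τ > 0, with probability at least 1 − 2·n²·e^{−2τ²}: max_{i,j} | (1/(n−1)^{k−1})·[Π^k]_{ij} − p^{(k)}(Xᵢ, Xⱼ) | ≤ 2·τ·k·δ^{−k}·n^{−1/2} + 2·k²·δ^{−k}·n^{−1}. -/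
open MeasureTheory

/-- Iterated transition kernel: `iterK μ p m = p^{(m+1)}`, i.e. `iterK μ p 0 = p` and
`iterK μ p (m+1) (x, y) = ∫ p(x,z) · iterK μ p m (z, y) dμ(z)`, so that
`p^{(k)} = iterK μ p (k-1)` is the `k`-step kernel
`p^{(k)}(x,y) = ∫_{χ^{k−1}} p(x,z₁)·p(z₁,z₂)⋯p(z_{k−1},y) dμ(z₁)⋯dμ(z_{k−1})`. -/
noncomputable def iterK {χ : Type*} [MeasurableSpace χ] (μ : Measure χ)
    (p : χ → χ → ℝ) : ℕ → χ → χ → ℝ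
  | 0, x, y => p x y
  | (m + 1), x, y => ∫ z, p x z * iterK μ p m z y ∂μ

section IterK

variable {χ : Type*} [MeasurableSpace χ] {μ : Measure χ} {p : χ → χ → ℝ}

lemma measurable_iterK [SFinite μ] (hp : Measurable fun q : χ × χ => p q.1 q.2) (m : ℕ) :
    Measurable fun q : χ × χ => iterK μ p m q.1 q.2 := by
  induction m with
  | zero => exact hp
  | succ m ih =>
    have h : Measurable fun r : (χ × χ) × χ => p r.1.1 r.2 * iterK μ p m r.2 r.1.2 :=
      (hp.comp (by fun_prop : Measurable fun r : (χ × χ) × χ => (r.1.1, r.2))).mul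
        (ih.comp (by fun_prop : Measurable fun r : (χ × χ) × χ => (r.2, r.1.2)))
    exact h.stronglyMeasurable.integral_prod_right'.measurable

lemma integral_mem_Icc [IsProbabilityMeasure μ] {f : χ → ℝ} (hf : Measurable f) {a b : ℝ}
    (h : ∀ z, f z ∈ Set.Icc a b) : ∫ z, f z ∂μ ∈ Set.Icc a b := by
  have hint : Integrable f μ := .of_mem_Icc a b hf.aemeasurable (.of_forall h)
  constructor
  · simpa using integral_mono (integrable_const a) hint fun z => (h z).1
  · simpa using integral_mono hint (integrable_const b) fun z => (h z).2

lemma iterK_mem_Icc [IsProbabilityMeasure μ] (hp : Measurable fun q : χ × χ => p q.1 q.2)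
    {M : ℝ} (hpM : ∀ x y, p x y ∈ Set.Icc 0 M) (m : ℕ) (x y : χ) :
    iterK μ p m x y ∈ Set.Icc 0 (M ^ (m + 1)) := by
  induction m generalizing x y with
  | zero => simpa [iterK] using hpM x y
  | succ m ih =>
    refine integral_mem_Icc ?_ fun z => ⟨mul_nonneg (hpM x z).1 (ih z y).1, ?_⟩
    · exact (hp.comp measurable_prodMk_left).mul
        ((measurable_iterK hp m).comp measurable_prodMk_right)
    · rw [pow_succ' M (m + 1)]
      exact mul_le_mul (hpM x z).2 (ih z y).2 (ih z y).1 ((hpM x z).1.trans (hpM x z).2)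

end IterK

section Hoeffding

variable {χ ι : Type*} [MeasurableSpace χ] [Fintype ι] {μ : Measure χ} [IsProbabilityMeasure μ]

/-- One-sided Hoeffding inequality for i.i.d. samples. -/
lemma pi_sum_sub_integral_ge_le {f : χ → ℝ} (hf : Measurable f) {a b : ℝ}
    (hab : ∀ z, f z ∈ Set.Icc a b) {s : ℝ} (hs : 0 ≤ s) :
    (Measure.pi fun _ : ι => μ).real {Y | s ≤ ∑ l, (f (Y l) - ∫ z, f z ∂μ)} ≤
      Real.exp (-2 * s ^ 2 / (Fintype.card ι * (b - a) ^ 2)) := by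
  have hindep : ProbabilityTheory.iIndepFun
      (fun (l : ι) (Y : ι → χ) => f (Y l) - ∫ z, f z ∂μ) (Measure.pi fun _ : ι => μ) :=
    ProbabilityTheory.iIndepFun_pi (X := fun _ z => f z - ∫ z, f z ∂μ)
      fun _ => (hf.sub_const _).aemeasurable
  have hsub : ∀ l ∈ (Finset.univ : Finset ι), ProbabilityTheory.HasSubgaussianMGF
      (fun Y : ι → χ => f (Y l) - ∫ z, f z ∂μ) ((‖b - a‖₊ / 2) ^ 2)
      (Measure.pi fun _ : ι => μ) := by
    intro l _
    have hmp := measurePreserving_eval (fun _ : ι => μ) l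
    have hint : ∫ Y : ι → χ, f (Y l) ∂(Measure.pi fun _ : ι => μ) = ∫ z, f z ∂μ := by
      have h := integral_map (μ := Measure.pi fun _ : ι => μ) hmp.measurable.aemeasurable
        (f := f) hf.stronglyMeasurable.aestronglyMeasurable
      rw [hmp.map_eq] at h
      exact h.symm
    rw [← hint]
    exact ProbabilityTheory.hasSubgaussianMGF_of_mem_Icc
      (hf.comp (measurable_pi_apply l)).aemeasurable (.of_forall fun Y => hab (Y l))
  refine (ProbabilityTheory.HasSubgaussianMGF.measure_sum_ge_le_of_iIndepFun hindep hsub hs).trans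
    (le_of_eq ?_)
  congr 1
  simp only [Finset.sum_const, Finset.card_univ, nsmul_eq_mul]
  push_cast
  rw [Real.norm_eq_abs, div_pow, sq_abs,
    show (2 : ℝ) * (Fintype.card ι * ((b - a) ^ 2 / 2 ^ 2)) =
      (Fintype.card ι * (b - a) ^ 2) / 2 by ring, div_div_eq_mul_div]
  ring

/-- Two-sided Hoeffding inequality for i.i.d. samples. -/
lemma pi_abs_sum_sub_integral_ge_le {f : χ → ℝ} (hf : Measurable f) {B : ℝ}
    (hB : ∀ z, f z ∈ Set.Icc 0 B) {s : ℝ} (hs : 0 ≤ s) :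
    (Measure.pi fun _ : ι => μ) {Y | s ≤ |∑ l, (f (Y l) - ∫ z, f z ∂μ)|} ≤
      ENNReal.ofReal (2 * Real.exp (-2 * s ^ 2 / (Fintype.card ι * B ^ 2))) := by
  have h1 := pi_sum_sub_integral_ge_le (ι := ι) (μ := μ) hf hB hs
  have h2 := pi_sum_sub_integral_ge_le (ι := ι) (μ := μ) hf.neg (a := -B) (b := 0)
    (fun z => ⟨neg_le_neg (hB z).2, by simpa using (hB z).1⟩) hs
  rw [sub_zero] at h1
  rw [sub_neg_eq_add, zero_add] at h2
  have hsubset : {Y : ι → χ | s ≤ |∑ l, (f (Y l) - ∫ z, f z ∂μ)|} ⊆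
      {Y | s ≤ ∑ l, (f (Y l) - ∫ z, f z ∂μ)} ∪
        {Y | s ≤ ∑ l, ((-f) (Y l) - ∫ z, (-f) z ∂μ)} := by
    intro Y hY
    rcases le_abs.1 (show s ≤ |_| from hY) with h | h
    · exact Or.inl h
    · refine Or.inr (h.trans (le_of_eq ?_))
      rw [← Finset.sum_neg_distrib]
      refine Finset.sum_congr rfl fun l _ => ?_
      simp only [Pi.neg_apply, integral_neg]
      ring
  refine ENNReal.le_ofReal_iff_toReal_le (measure_ne_top _ _) (by positivity) |>.2 ?_
  change (Measure.pi fun _ : ι => μ).real _ ≤ _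
  linarith [measureReal_mono hsubset (μ := Measure.pi fun _ : ι => μ),
    measureReal_union_le (μ := Measure.pi fun _ : ι => μ)
      {Y | s ≤ ∑ l, (f (Y l) - ∫ z, f z ∂μ)} {Y | s ≤ ∑ l, ((-f) (Y l) - ∫ z, (-f) z ∂μ)}]

/-- Hoeffding inequality, conditionally on two of the sampled points. -/
lemma pi_abs_sum_sub_integral_ge_le_of_pair [DecidableEq ι] {g : χ → χ → χ → ℝ}
    (hg : Measurable fun q : (χ × χ) × χ => g q.1.1 q.1.2 q.2) {B : ℝ}
    (hB : ∀ x y z, g x y z ∈ Set.Icc 0 B) {s : ℝ} (hs : 0 ≤ s) (i j : ι) :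
    (Measure.pi fun _ : ι => μ)
        {X | s ≤ |∑ l with ¬(l = i ∨ l = j), (g (X i) (X j) (X l) - ∫ z, g (X i) (X j) z ∂μ)|} ≤
      ENNReal.ofReal (2 * Real.exp
        (-2 * s ^ 2 / (Fintype.card {l // ¬(l = i ∨ l = j)} * B ^ 2))) := by
  let P : ι → Prop := fun l => l = i ∨ l = j
  let F : ({l // P l} → χ) × ({l // ¬P l} → χ) → ℝ := fun w =>
    ∑ l, (g (w.1 ⟨i, Or.inl rfl⟩) (w.1 ⟨j, Or.inr rfl⟩) (w.2 l) -
      ∫ z, g (w.1 ⟨i, Or.inl rfl⟩) (w.1 ⟨j, Or.inr rfl⟩) z ∂μ)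
  have hI : Measurable fun q : χ × χ => ∫ z, g q.1 q.2 z ∂μ :=
    hg.stronglyMeasurable.integral_prod_right'.measurable
  have hF : Measurable F := by
    refine Finset.measurable_sum _ fun l _ => .sub ?_ ?_
    · exact hg.comp (by fun_prop : Measurable fun w : ({l // P l} → χ) × ({l // ¬P l} → χ) =>
        ((w.1 ⟨i, Or.inl rfl⟩, w.1 ⟨j, Or.inr rfl⟩), w.2 l))
    · exact hI.comp (by fun_prop : Measurable fun w : ({l // P l} → χ) × ({l // ¬P l} → χ) =>
        (w.1 ⟨i, Or.inl rfl⟩, w.1 ⟨j, Or.inr rfl⟩))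
  have hS : MeasurableSet {w | s ≤ |F w|} := measurableSet_le measurable_const hF.abs
  have hpre : {X : ι → χ |
      s ≤ |∑ l with ¬(l = i ∨ l = j), (g (X i) (X j) (X l) - ∫ z, g (X i) (X j) z ∂μ)|} =
      MeasurableEquiv.piEquivPiSubtypeProd (fun _ : ι => χ) P ⁻¹' {w | s ≤ |F w|} := by
    ext X
    simp only [Set.mem_ofPred_eq, Set.mem_preimage]
    rw [← Finset.sum_subtype_eq_sum_filter, Finset.subtype_univ]
    rfl
  rw [hpre, (measurePreserving_piEquivPiSubtypeProd (fun _ : ι => μ) P).measure_preimage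
    hS.nullMeasurableSet, Measure.prod_apply hS]
  have hfib : ∀ a : {l // P l} → χ,
      (Measure.pi fun _ : {l // ¬P l} => μ) (Prod.mk a ⁻¹' {w | s ≤ |F w|}) ≤
        ENNReal.ofReal (2 * Real.exp (-2 * s ^ 2 / (Fintype.card {l // ¬P l} * B ^ 2))) :=
    fun a => pi_abs_sum_sub_integral_ge_le (hg.comp (measurable_prodMk_left
      (x := (a ⟨i, Or.inl rfl⟩, a ⟨j, Or.inr rfl⟩)))) (hB _ _) hs
  refine (lintegral_mono hfib).trans (le_of_eq ?_)
  rw [lintegral_const, measure_univ, mul_one]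

end Hoeffding

section MatrixPower

variable {ι : Type*} [Fintype ι] [DecidableEq ι] {A : Matrix ι ι ℝ} {M N : ℝ}

lemma sum_mul_le_of_diag_zero (hA : ∀ i j, A i j ∈ Set.Icc 0 M) (hdiag : ∀ i, A i i = 0)
    (hN : N = (Fintype.card ι : ℝ) - 1) {v : ι → ℝ} {e : ℝ} (hv : ∀ l, |v l| ≤ e) (i : ι) :
    |∑ l, A i l * v l| ≤ N * (M * e) := by
  have : Nonempty ι := ⟨i⟩
  have he : 0 ≤ e := (abs_nonneg _).trans (hv i)
  rw [← Finset.add_sum_erase _ _ (Finset.mem_univ i), hdiag, zero_mul, zero_add]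
  refine (Finset.abs_sum_le_sum_abs _ _).trans ?_
  refine (Finset.sum_le_card_nsmul _ _ (M * e) fun l _ => ?_).trans (le_of_eq ?_)
  · rw [abs_mul, abs_of_nonneg (hA i l).1]
    exact mul_le_mul (hA i l).2 (hv l) (abs_nonneg _) ((hA i l).1.trans (hA i l).2)
  · rw [Finset.card_erase_of_mem (Finset.mem_univ i), Finset.card_univ, nsmul_eq_mul,
      Nat.cast_sub Fintype.card_pos, Nat.cast_one, hN]

/-- Approximate powers of a matrix with vanishing diagonal: one-step errors accumulate linearly. -/
lemma abs_pow_sub_le_of_step (hA : ∀ i j, A i j ∈ Set.Icc 0 M) (hdiag : ∀ i, A i i = 0)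
    (hN : N = (Fintype.card ι : ℝ) - 1) (hN0 : 0 < N) {Q : ℕ → ι → ι → ℝ}
    (hQ : ∀ i j, i ≠ j → Q 0 i j = A i j) (hQd : ∀ i, Q 0 i i ∈ Set.Icc 0 M) {u : ℝ} {m : ℕ}
    (hstep : ∀ r ≤ m, ∀ i j,
      |N⁻¹ * ∑ l, A i l * Q r l j - Q (r + 1) i j| ≤ M ^ (r + 2) * (u + 1 / N)) (i j : ι) :
    |(N ^ (m + 1))⁻¹ * (A ^ (m + 2)) i j - Q (m + 1) i j| ≤
      M ^ (m + 2) * ((m + 1) * u + (m + 2) / N) := by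
  have hM : 0 ≤ M := (hA i i).1.trans (hA i i).2
  have hsplit : ∀ (r : ℕ) (i j : ι), (N ^ (r + 1))⁻¹ * (A ^ (r + 2)) i j - Q (r + 1) i j =
      N⁻¹ * ∑ l, A i l * ((N ^ r)⁻¹ * (A ^ (r + 1)) l j - Q r l j) +
        (N⁻¹ * ∑ l, A i l * Q r l j - Q (r + 1) i j) := by
    intro r i j
    have : ∑ l, A i l * ((N ^ r)⁻¹ * (A ^ (r + 1)) l j - Q r l j) =
        (N ^ r)⁻¹ * (A ^ (r + 2)) i j - ∑ l, A i l * Q r l j := by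
      rw [pow_succ' A (r + 1), Matrix.mul_apply, Finset.mul_sum, ← Finset.sum_sub_distrib]
      exact Finset.sum_congr rfl fun l _ => by ring
    rw [this, pow_succ, mul_inv]
    ring
  induction m generalizing i j with
  | zero =>
    rw [hsplit]
    have hdiagterm : |∑ l, A i l * ((N ^ 0)⁻¹ * (A ^ (0 + 1)) l j - Q 0 l j)| ≤ M ^ 2 := by
      rw [Finset.sum_eq_single j]
      · simp only [pow_zero, inv_one, one_mul, zero_add, pow_one, hdiag, zero_sub, abs_mul,
          abs_neg, abs_of_nonneg (hA i j).1, abs_of_nonneg (hQd j).1, sq]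
        exact mul_le_mul (hA i j).2 (hQd j).2 (hQd j).1 hM
      · intro l _ hl
        simp [hQ l j hl]
      · simp
    have h1 := hstep 0 le_rfl i j
    calc _ ≤ N⁻¹ * M ^ 2 + M ^ (0 + 2) * (u + 1 / N) := by
          refine (abs_add_le _ _).trans (add_le_add ?_ h1)
          rw [abs_mul, abs_of_pos (inv_pos.2 hN0)]
          gcongr
      _ = _ := by push_cast; ring
  | succ m ih =>
    rw [hsplit]
    have ih' := ih (fun r hr => hstep r (by lia))
    have h1 := hstep (m + 1) le_rfl i j
    have h2 := sum_mul_le_of_diag_zero hA hdiag hN (fun l => ih' l j) i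
    calc _ ≤ N⁻¹ * (N * (M * (M ^ (m + 2) * ((m + 1) * u + (m + 2) / N)))) +
            M ^ (m + 1 + 2) * (u + 1 / N) := by
          refine (abs_add_le _ _).trans (add_le_add ?_ h1)
          rw [abs_mul, abs_of_pos (inv_pos.2 hN0)]
          gcongr
      _ = _ := by
          rw [inv_mul_cancel_left₀ hN0.ne']
          push_cast
          ring

end MatrixPower

/-- Passing from the sum over the indices different from `i` and `j` to a row of the matrix. -/
lemma abs_inv_mul_sum_sub_le {ι : Type*} [Fintype ι] [DecidableEq ι] {f : ι → ℝ} {B I N s : ℝ}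
    (hf : ∀ l, f l ∈ Set.Icc 0 B) (hI : I ∈ Set.Icc 0 B)
    (hN : N = (Fintype.card ι : ℝ) - 1) (hN0 : 0 < N) (i j : ι)
    (hs : |∑ l with ¬(l = i ∨ l = j), (f l - I)| ≤ s) :
    |N⁻¹ * ∑ l, (if i = l then 0 else f l) - I| ≤ (s + B) / N := by
  have : Nonempty ι := ⟨i⟩
  have hrow : ∑ l, (if i = l then 0 else f l) - N * I = ∑ l ∈ Finset.univ.erase i, (f l - I) := by
    rw [Finset.sum_sub_distrib, Finset.sum_const, Finset.card_erase_of_mem (Finset.mem_univ i),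
      Finset.card_univ, nsmul_eq_mul, Nat.cast_sub Fintype.card_pos, Nat.cast_one, ← hN,
      ← Finset.add_sum_erase _ _ (Finset.mem_univ i)]
    simp only [if_true, zero_add]
    congr 1
    exact Finset.sum_congr rfl fun l hl => if_neg (Finset.ne_of_mem_erase hl).symm
  have hdev : |f j - I| ≤ B := by
    rw [abs_le]
    constructor <;> linarith [(hf j).1, (hf j).2, hI.1, hI.2]
  have hsum : |∑ l ∈ Finset.univ.erase i, (f l - I)| ≤ s + B := by
    by_cases hij : j = i
    · have : (Finset.univ.erase i : Finset ι) = Finset.univ.filter fun l => ¬(l = i ∨ l = j) := by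
        ext l
        simp [hij]
      rw [this]
      linarith [abs_nonneg (f j - I)]
    · have hj : j ∈ (Finset.univ.erase i : Finset ι) := by simp [hij]
      have : ((Finset.univ.erase i).erase j : Finset ι) =
          Finset.univ.filter fun l => ¬(l = i ∨ l = j) := by
        ext l
        simp [and_comm]
      rw [← Finset.add_sum_erase _ _ hj, this]
      linarith [abs_add_le (f j - I) (∑ l with ¬(l = i ∨ l = j), (f l - I))]
  have heq : N⁻¹ * ∑ l, (if i = l then 0 else f l) - I =
      (∑ l ∈ Finset.univ.erase i, (f l - I)) / N := by
    rw [← hrow]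
    field_simp
  rw [heq, abs_div, abs_of_pos hN0]
  gcongr

/-- The Hoeffding exponent of one entry is at least `4 * τ ^ 2`. -/
lemma exp_hoeffding_le {n c B τ : ℝ} (hn : 2 ≤ n) (hc0 : 0 < c) (hc : c ≤ n - 1) (hB : 0 < B) :
    Real.exp (-2 * (2 * τ / Real.sqrt n * B * (n - 1)) ^ 2 / (c * B ^ 2)) ≤
      Real.exp (-4 * τ ^ 2) := by
  have hn0 : 0 < n := by linarith
  refine Real.exp_le_exp.2 ?_
  rw [div_le_iff₀ (by positivity)]
  have h : (2 * τ / Real.sqrt n * B * (n - 1)) ^ 2 = 4 * τ ^ 2 * B ^ 2 * ((n - 1) ^ 2 / n) := by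
    rw [mul_pow, mul_pow, div_pow, Real.sq_sqrt hn0.le]
    ring
  have h2 : c / 2 ≤ (n - 1) ^ 2 / n := by
    rw [div_le_div_iff₀ two_pos hn0]
    nlinarith
  rw [h]
  nlinarith [mul_le_mul_of_nonneg_left h2 (by positivity : 0 ≤ 8 * τ ^ 2 * B ^ 2)]

/-- Concentration of the powered normalized kernel matrix on i.i.d. sampled points: with
probability at least `1 − 2n²e^{−2τ²}`, uniformly over entries,
`|(1/(n−1)^{k−1})·[Π^k]_{ij} − p^{(k)}(Xᵢ, Xⱼ)| ≤ 2τk·δ^{−k}/√n + 2k²·δ^{−k}/n`. -/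
theorem stmt10
    {χ : Type*} [MeasurableSpace χ] (μ : Measure χ) [IsProbabilityMeasure μ]
    (δ : ℝ) (hδ0 : 0 < δ) (hδ1 : δ ≤ 1)
    (p : χ → χ → ℝ) (hpmeas : Measurable fun q : χ × χ => p q.1 q.2)
    (hp0 : ∀ x y, 0 ≤ p x y) (hp1 : ∀ x y, p x y ≤ 1 / δ)
    (k n : ℕ) (hk : 2 ≤ k) (hn : 2 * k ≤ n)
    (τ : ℝ) (hτ : 0 < τ) :
    ENNReal.ofReal (1 - 2 * n ^ 2 * Real.exp (-2 * τ ^ 2)) ≤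
      Measure.pi (fun _ : Fin n => μ)
        {X : Fin n → χ | ∀ i j : Fin n,
          |(((n : ℝ) - 1) ^ (k - 1))⁻¹ *
              (((Matrix.of fun i' j' : Fin n =>
                  if i' = j' then (0 : ℝ) else p (X i') (X j')) ^ k) i j) -
            iterK μ p (k - 1) (X i) (X j)| ≤
          2 * τ * k * (δ ^ k)⁻¹ / Real.sqrt n + 2 * k ^ 2 * (δ ^ k)⁻¹ / n} := by
  obtain ⟨m, rfl⟩ : ∃ m, k = m + 2 := ⟨k - 2, by lia⟩
  rcases le_or_gt (1 - 2 * (n : ℝ) ^ 2 * Real.exp (-2 * τ ^ 2)) 0 with htriv | hpos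
  · rw [ENNReal.ofReal_of_nonpos htriv]
    exact zero_le
  set M : ℝ := 1 / δ with hMdef
  have hM : 0 < M := by positivity
  have hpM : ∀ x y, p x y ∈ Set.Icc 0 M := fun x y => ⟨hp0 x y, hp1 x y⟩
  have hn4 : 4 ≤ n := by lia
  have hn4' : (4 : ℝ) ≤ n := by exact_mod_cast hn4
  have hkn : 2 * ((m : ℝ) + 2) ≤ n := by exact_mod_cast hn
  have hN0 : (0 : ℝ) < n - 1 := by linarith
  let u : ℝ := 2 * τ / Real.sqrt n
  have hu : 0 < u := by positivity
  let g : ℕ → χ → χ → χ → ℝ := fun r x y z => p x z * iterK μ p r z y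
  let s : ℕ → ℝ := fun r => u * M ^ (r + 2) * (n - 1)
  have hgmeas : ∀ r, Measurable fun q : (χ × χ) × χ => g r q.1.1 q.1.2 q.2 := fun r =>
    (hpmeas.comp (by fun_prop : Measurable fun q : (χ × χ) × χ => (q.1.1, q.2))).mul
      ((measurable_iterK hpmeas r).comp
        (by fun_prop : Measurable fun q : (χ × χ) × χ => (q.2, q.1.2)))
  have hgM : ∀ r x y z, g r x y z ∈ Set.Icc 0 (M ^ (r + 2)) := fun r x y z => by
    have h := iterK_mem_Icc (μ := μ) hpmeas hpM r z y
    refine ⟨mul_nonneg (hpM x z).1 h.1, ?_⟩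
    rw [pow_succ' M (r + 1)]
    exact mul_le_mul (hpM x z).2 h.2 h.1 hM.le
  let bad : ℕ → Fin n → Fin n → Set (Fin n → χ) := fun r i j => {X | s r ≤
    |∑ l with ¬(l = i ∨ l = j), (g r (X i) (X j) (X l) - ∫ z, g r (X i) (X j) z ∂μ)|}
  have hbad : ∀ r i j, Measure.pi (fun _ : Fin n => μ) (bad r i j) ≤
      ENNReal.ofReal (2 * Real.exp (-4 * τ ^ 2)) := fun r i j => by
    have hcard : Fintype.card {l // ¬(l = i ∨ l = j)} + ({i, j} : Finset (Fin n)).card = n := by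
      have h := Finset.card_compl_add_card ({i, j} : Finset (Fin n))
      rw [Fintype.card_fin] at h
      rw [Fintype.card_subtype]
      convert h using 3
      ext l
      simp
    have hle := Finset.card_le_two (a := i) (b := j)
    have hge : 0 < ({i, j} : Finset (Fin n)).card := Finset.card_pos.2 ⟨i, by simp⟩
    refine (pi_abs_sum_sub_integral_ge_le_of_pair (hgmeas r) (hgM r) (by positivity) i j).trans
      (ENNReal.ofReal_le_ofReal (mul_le_mul_of_nonneg_left
        (exp_hoeffding_le (by linarith) ?_ ?_ (by positivity)) two_pos.le))
    · exact_mod_cast (by lia : 0 < Fintype.card {l // ¬(l = i ∨ l = j)})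
    · rw [le_sub_iff_add_le]
      exact_mod_cast (by lia : Fintype.card {l // ¬(l = i ∨ l = j)} + 1 ≤ n)
  let Bad : Set (Fin n → χ) := ⋃ r : Fin (m + 1), ⋃ i, ⋃ j, bad r i j
  have hBad : Measure.pi (fun _ : Fin n => μ) Bad ≤
      ENNReal.ofReal (2 * n ^ 2 * Real.exp (-2 * τ ^ 2)) := by
    calc Measure.pi (fun _ : Fin n => μ) Bad
        ≤ ∑ _r : Fin (m + 1), ∑ _i : Fin n, ∑ _j : Fin n,
            ENNReal.ofReal (2 * Real.exp (-4 * τ ^ 2)) := by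
          refine (measure_iUnion_fintype_le _ _).trans (Finset.sum_le_sum fun r _ => ?_)
          refine (measure_iUnion_fintype_le _ _).trans (Finset.sum_le_sum fun i _ => ?_)
          exact (measure_iUnion_fintype_le _ _).trans (Finset.sum_le_sum fun j _ => hbad r i j)
      _ = ENNReal.ofReal (((m + 1 : ℕ) : ℝ) * (n * (n * (2 * Real.exp (-4 * τ ^ 2))))) := by
          rw [ENNReal.ofReal_mul (Nat.cast_nonneg _), ENNReal.ofReal_mul (Nat.cast_nonneg n),
            ENNReal.ofReal_mul (Nat.cast_nonneg n), ENNReal.ofReal_natCast,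
            ENNReal.ofReal_natCast]
          simp only [Finset.sum_const, Finset.card_univ, Fintype.card_fin, nsmul_eq_mul]
      _ ≤ _ := by
          refine ENNReal.ofReal_le_ofReal ?_
          have hexp : Real.exp (-4 * τ ^ 2) = Real.exp (-2 * τ ^ 2) * Real.exp (-2 * τ ^ 2) := by
            rw [← Real.exp_add]
            ring_nf
          have he : 0 < Real.exp (-2 * τ ^ 2) := Real.exp_pos _
          have hsmall : ((m : ℝ) + 1) * Real.exp (-2 * τ ^ 2) ≤ 1 := by nlinarith
          rw [hexp]
          push_cast
          nlinarith [mul_le_mul_of_nonneg_left hsmall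
            (by positivity : 0 ≤ 2 * (n : ℝ) ^ 2 * Real.exp (-2 * τ ^ 2))]
  have hsub : Badᶜ ⊆ {X : Fin n → χ | ∀ i j : Fin n,
      |(((n : ℝ) - 1) ^ (m + 2 - 1))⁻¹ *
          (((Matrix.of fun i' j' : Fin n =>
              if i' = j' then (0 : ℝ) else p (X i') (X j')) ^ (m + 2)) i j) -
        iterK μ p (m + 2 - 1) (X i) (X j)| ≤
      2 * τ * (m + 2 : ℕ) * (δ ^ (m + 2))⁻¹ / Real.sqrt n +
        2 * (m + 2 : ℕ) ^ 2 * (δ ^ (m + 2))⁻¹ / n} := by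
    intro X hX i j
    simp only [Bad, bad, Set.mem_compl_iff, Set.mem_iUnion, Set.mem_ofPred_eq, not_exists,
      not_le] at hX
    have hcardN : (n : ℝ) - 1 = (Fintype.card (Fin n) : ℝ) - 1 := by simp
    have hkey := abs_pow_sub_le_of_step
      (A := Matrix.of fun i' j' : Fin n => if i' = j' then (0 : ℝ) else p (X i') (X j'))
      (M := M) (N := (n : ℝ) - 1) (Q := fun r i j => iterK μ p r (X i) (X j)) (u := u) (m := m)
      ?_ ?_ hcardN hN0 ?_ ?_ ?_ i j
    · have hδM : (δ ^ (m + 2))⁻¹ = M ^ (m + 2) := by rw [hMdef, one_div, inv_pow]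
      rw [hδM, show m + 2 - 1 = m + 1 by lia]
      refine hkey.trans ?_
      have h1 : ((m : ℝ) + 1) * u ≤ 2 * τ * (m + 2) / Real.sqrt n := by
        rw [show 2 * τ * ((m : ℝ) + 2) / Real.sqrt n = (m + 2) * u by simp only [u]; ring]
        gcongr
        norm_num
      have h2 : ((m : ℝ) + 2) / (n - 1) ≤ 2 * (m + 2) ^ 2 / n := by
        rw [div_le_div_iff₀ hN0 (by linarith)]
        have hm : (0 : ℝ) ≤ m := Nat.cast_nonneg m
        nlinarith [mul_nonneg hm hm, mul_nonneg hm hN0.le, mul_nonneg (mul_nonneg hm hm) hN0.le]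
      calc _ ≤ M ^ (m + 2) * (2 * τ * (m + 2) / Real.sqrt n + 2 * (m + 2) ^ 2 / n) := by gcongr
        _ = _ := by push_cast; ring
    · intro i j
      simp only [Matrix.of_apply]
      split_ifs
      · exact ⟨le_rfl, hM.le⟩
      · exact hpM _ _
    · simp
    · intro i j hij
      simp [iterK, hij]
    · exact fun i => hpM _ _
    · intro r hr i j
      have h := abs_inv_mul_sum_sub_le (f := fun l => g r (X i) (X j) (X l))
        (fun l => hgM r _ _ _)
        (integral_mem_Icc (μ := μ) (f := g r (X i) (X j))
          ((hgmeas r).comp (measurable_prodMk_left (x := (X i, X j)))) (hgM r (X i) (X j)))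
        hcardN hN0 i j (hX ⟨r, by lia⟩ i j).le
      simp only [Matrix.of_apply, ite_mul, zero_mul]
      refine h.trans (le_of_eq ?_)
      simp only [s]
      field_simp
  have huniv : (1 : ENNReal) ≤ Measure.pi (fun _ : Fin n => μ) Badᶜ +
      Measure.pi (fun _ : Fin n => μ) Bad := by
    rw [← measure_univ (μ := Measure.pi (fun _ : Fin n => μ)), ← Set.compl_union_self Bad]
    exact measure_union_le _ _
  rw [ENNReal.ofReal_sub _ (by positivity), ENNReal.ofReal_one]
  refine tsub_le_iff_right.2 (huniv.trans (add_le_add (measure_mono hsub) hBad))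
end

section
/- Let n ≥ 2, α ∈ [1/2, 1], and γ = n^{α−1}. Let A be a (deterministic) symmetric n×n matrix with entries in [0,1] and zero diagonal, and let Â be a random symmetric n×n matrix whose entries Â_{ij} = Â_{ji} for i < j are independent Bernoulli random variables with success probabilities γ·A_{ij}, and Â_{ii} = 0. Then for every fixed pair i ≠ j and every τ > 0: P[ |[A²]_{ij} − γ^{−2}·[Â²]_{ij}| ≥ 2·τ·n^{3/2−α} ] ≤ 2·e^{−τ²/(1+τ)}. -/
open MeasureTheory

/-- Bernoulli measure on `Bool` with success probability `p`. -/
noncomputable def bern (p : ℝ) : Measure Bool :=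
  ENNReal.ofReal (1 - p) • Measure.dirac false + ENNReal.ofReal p • Measure.dirac true

/-- The law of the independent edge indicators of the subsampled graph: each edge
`{i, j}` with `i < j` is present independently with probability `γ · A i j`. -/
noncomputable def edgeMeasure {n : ℕ} (A : Matrix (Fin n) (Fin n) ℝ) (γ : ℝ) :
    Measure ({q : Fin n × Fin n // q.1 < q.2} → Bool) :=
  Measure.pi fun q => bern (γ * A q.1.1 q.1.2)

/-- The (symmetric, zero-diagonal) adjacency matrix built from the edge indicators. -/
noncomputable def hatA {n : ℕ} (e : {q : Fin n × Fin n // q.1 < q.2} → Bool) :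
    Matrix (Fin n) (Fin n) ℝ :=
  Matrix.of fun i j =>
    if h : i < j then (if e ⟨(i, j), h⟩ then 1 else 0)
    else if h' : j < i then (if e ⟨(j, i), h'⟩ then 1 else 0)
    else 0

open ProbabilityTheory

section Chernoff

variable {Ω κ : Type*} [MeasurableSpace Ω] {μ : Measure Ω}

/-- The moment generating function of a sum of products `Y k * Z k` factorizes when all the
`Y k`, `Z k` are jointly independent. -/
lemma mgf_sum_mul_of_iIndepFun {Y Z : κ → Ω → ℝ} (hY : ∀ k, Measurable (Y k))
    (hZ : ∀ k, Measurable (Z k)) (h : iIndepFun (Sum.elim Y Z) μ) (s : Finset κ) (t : ℝ) :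
    mgf (∑ k ∈ s, Y k * Z k) μ t = ∏ k ∈ s, mgf (Y k * Z k) μ t := by
  classical
  have := h.isProbabilityMeasure
  induction s using Finset.induction_on with
  | empty => simp
  | insert m s hm ih =>
    have hmeas : ∀ x, Measurable (Sum.elim Y Z x) := by
      rintro (k | k)
      exacts [hY k, hZ k]
    have hdisj : Disjoint (({m} : Finset κ).disjSum {m}) (s.disjSum s) := by
      rw [Finset.disjoint_left]
      rintro (k | k) <;> simp +contextual [hm]
    have hind : IndepFun (Y m * Z m) (∑ k ∈ s, Y k * Z k) μ := by
      have h₁ := h.indepFun_finset _ _ hdisj hmeas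
      have hφ : Measurable fun v : ({m} : Finset κ).disjSum {m} → ℝ =>
          v ⟨Sum.inl m, by simp⟩ * v ⟨Sum.inr m, by simp⟩ := by fun_prop
      have hψ : Measurable fun v : s.disjSum s → ℝ =>
          ∑ k : s, v ⟨Sum.inl k.1, by simp⟩ * v ⟨Sum.inr k.1, by simp⟩ := by fun_prop
      have h₂ := h₁.comp hφ hψ
      convert! h₂ using 1
      ext ω
      simp only [Finset.sum_apply, Pi.mul_apply, Function.comp_apply, Sum.elim_inl, Sum.elim_inr]
      exact (Finset.sum_coe_sort s fun k => Y k ω * Z k ω).symm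
    have hsum : Measurable (∑ k ∈ s, Y k * Z k) := by fun_prop
    rw [Finset.sum_insert hm, Finset.prod_insert hm, ← ih]
    exact hind.mgf_add (((hY m).mul (hZ m)).const_mul t).exp.aestronglyMeasurable
      (hsum.const_mul t).exp.aestronglyMeasurable

lemma mgf_le_of_zero_or_one [IsProbabilityMeasure μ] {X : Ω → ℝ} (hX : Measurable X)
    (h01 : ∀ ω, X ω = 0 ∨ X ω = 1) (t : ℝ) :
    mgf X μ t ≤ Real.exp (μ[X] * (Real.exp t - 1)) := by
  have hint : Integrable X μ := Integrable.of_bound hX.aestronglyMeasurable 1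
    (ae_of_all _ fun ω => by rcases h01 ω with h | h <;> simp [h])
  have heq : (fun ω => Real.exp (t * X ω)) = fun ω => 1 + X ω * (Real.exp t - 1) := by
    ext ω
    rcases h01 ω with h | h <;> simp [h]
  rw [mgf, heq, integral_add (integrable_const _) (hint.mul_const _), integral_mul_const]
  simp only [integral_const, probReal_univ, one_smul]
  linarith [Real.add_one_le_exp (μ[X] * (Real.exp t - 1))]

/-- Bernstein-type tail bound for a sum of products of independent `{0, 1}`-valued variables with
mean at most `s ^ 2`. -/
lemma measureReal_abs_sub_ge_le [Fintype κ] {Y Z : κ → Ω → ℝ} (hY : ∀ k, Measurable (Y k))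
    (hZ : ∀ k, Measurable (Z k)) (h : iIndepFun (Sum.elim Y Z) μ)
    (hY01 : ∀ k ω, Y k ω = 0 ∨ Y k ω = 1) (hZ01 : ∀ k ω, Z k ω = 0 ∨ Z k ω = 1)
    {s τ V : ℝ} (hs : 1 ≤ s) (hτ : 0 < τ) (hV : ∑ k, μ[Y k * Z k] = V) (hVs : V ≤ s ^ 2) :
    μ.real {ω | 2 * τ * s ≤ |V - ∑ k, Y k ω * Z k ω|} ≤
      2 * Real.exp (-(τ ^ 2) / (1 + τ)) := by
  have := h.isProbabilityMeasure
  set S : Ω → ℝ := ∑ k, Y k * Z k with hS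
  have hSapp : ∀ ω, S ω = ∑ k, Y k ω * Z k ω := fun ω => by simp [hS]
  have hX01 : ∀ k ω, (Y k * Z k) ω = 0 ∨ (Y k * Z k) ω = 1 := fun k ω => by
    rcases hY01 k ω with h₁ | h₁ <;> rcases hZ01 k ω with h₂ | h₂ <;> simp [h₁, h₂]
  have hSm : Measurable S := by fun_prop
  have hS0 : ∀ ω, 0 ≤ S ω := fun ω => by
    rw [hS, Finset.sum_apply]
    refine Finset.sum_nonneg fun k _ => ?_
    rcases hX01 k ω with h | h <;> simp only [h] <;> norm_num
  have hScard : ∀ ω, S ω ≤ Fintype.card κ := fun ω => by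
    rw [hS, Finset.sum_apply]
    refine (Finset.sum_le_card_nsmul _ _ 1 fun k _ => ?_).trans (by simp)
    rcases hX01 k ω with h | h <;> simp only [h] <;> norm_num
  have hV0 : 0 ≤ V := hV ▸ Finset.sum_nonneg fun k _ => integral_nonneg fun ω => by
    rcases hX01 k ω with h | h <;> rw [h] <;> norm_num
  have hint : ∀ t : ℝ, Integrable (fun ω => Real.exp (t * S ω)) μ := fun t =>
    Integrable.of_bound (hSm.const_mul t).exp.aestronglyMeasurable
      (Real.exp (|t| * Fintype.card κ)) (ae_of_all _ fun ω => by
        rw [Real.norm_eq_abs, Real.abs_exp, Real.exp_le_exp]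
        calc t * S ω ≤ |t| * S ω := mul_le_mul_of_nonneg_right (le_abs_self t) (hS0 ω)
          _ ≤ _ := mul_le_mul_of_nonneg_left (hScard ω) (abs_nonneg t))
  have hmgf : ∀ t : ℝ, mgf S μ t ≤ Real.exp (V * (Real.exp t - 1)) := fun t => by
    rw [hS, mgf_sum_mul_of_iIndepFun hY hZ h, ← hV, Finset.sum_mul, Real.exp_sum]
    exact Finset.prod_le_prod (fun _ _ => mgf_nonneg) fun k _ =>
      mgf_le_of_zero_or_one ((hY k).mul (hZ k)) (hX01 k) t
  have htail : ∀ t : ℝ, |t| = τ / (1 + τ) / s → ∀ ε : ℝ, t * (ε - V) = |t| * (2 * τ * s) →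
      Real.exp (-t * ε) * mgf S μ t ≤ Real.exp (-(τ ^ 2) / (1 + τ)) := by
    intro t ht ε hε
    have hs0 : 0 < s := by linarith
    have hμ1 : τ / (1 + τ) ≤ 1 := (div_le_one (by linarith)).2 (by linarith)
    have ht1 : |t| ≤ 1 := by
      rw [ht]
      exact (div_le_one hs0).2 (hμ1.trans hs)
    have hquad : Real.exp t - 1 - t ≤ t ^ 2 :=
      (le_abs_self _).trans (Real.abs_exp_sub_one_sub_id_le ht1)
    have hts : |t| * s = τ / (1 + τ) := by rw [ht]; field_simp
    refine (mul_le_mul_of_nonneg_left (hmgf t) (Real.exp_pos _).le).trans ?_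
    rw [← Real.exp_add, Real.exp_le_exp]
    have h₁ : V * (Real.exp t - 1 - t) ≤ (|t| * s) ^ 2 := by
      calc V * (Real.exp t - 1 - t) ≤ V * t ^ 2 := mul_le_mul_of_nonneg_left hquad hV0
        _ ≤ s ^ 2 * t ^ 2 := mul_le_mul_of_nonneg_right hVs (sq_nonneg t)
        _ = (|t| * s) ^ 2 := by rw [mul_pow, sq_abs, mul_comm]
    have h₂ : (|t| * s) ^ 2 ≤ τ * (|t| * s) := by
      rw [hts, sq]
      exact mul_le_mul_of_nonneg_right (div_le_self hτ.le (by linarith)) (by positivity)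
    have h₃ : -(τ ^ 2) / (1 + τ) = -(τ * (|t| * s)) := by rw [hts]; ring
    rw [h₃]
    linarith
  have hl0 : 0 ≤ τ / (1 + τ) / s := by positivity
  have hupper := (measure_ge_le_exp_mul_mgf (V + 2 * τ * s) hl0 (hint _)).trans
    (htail _ (abs_of_nonneg hl0) _ (by rw [abs_of_nonneg hl0]; ring))
  have hlower := (measure_le_le_exp_mul_mgf (V - 2 * τ * s) (neg_nonpos.2 hl0) (hint _)).trans
    (htail _ (by rw [abs_neg, abs_of_nonneg hl0]) _
      (by rw [abs_neg, abs_of_nonneg hl0]; ring))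
  have hsub : {ω | 2 * τ * s ≤ |V - ∑ k, Y k ω * Z k ω|} ⊆
      {ω | V + 2 * τ * s ≤ S ω} ∪ {ω | S ω ≤ V - 2 * τ * s} := fun ω hω => by
    simp only [Set.mem_ofPred_eq, ← hSapp] at hω
    rcases le_abs.1 hω with h | h
    · exact Or.inr (by simp only [Set.mem_ofPred_eq]; linarith)
    · exact Or.inl (by simp only [Set.mem_ofPred_eq]; linarith)
  linarith [(measureReal_mono (μ := μ) hsub).trans (measureReal_union_le _ _)]

end Chernoff

lemma isProbabilityMeasure_bern {p : ℝ} (hp : p ∈ Set.Icc (0 : ℝ) 1) :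
    IsProbabilityMeasure (bern p) := by
  constructor
  simp only [bern, Measure.add_apply, Measure.smul_apply, measure_univ, smul_eq_mul, mul_one]
  rw [← ENNReal.ofReal_add (by linarith [hp.2]) hp.1]
  simp

lemma integral_bern {p : ℝ} (hp : p ∈ Set.Icc (0 : ℝ) 1) :
    ∫ b, (if b then (1 : ℝ) else 0) ∂bern p = p := by
  have := isProbabilityMeasure_bern hp
  rw [integral_fintype Integrable.of_finite]
  simp [bern, Measure.real, hp.1]

section Edges

variable {n : ℕ}

/-- The unordered pair `{a, b}` as an edge index. -/
def edge (a b : Fin n) (h : a ≠ b) : {q : Fin n × Fin n // q.1 < q.2} :=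
  ⟨(min a b, max a b), min_lt_max.2 h⟩

lemma hatA_apply_of_ne (e : {q : Fin n × Fin n // q.1 < q.2} → Bool) {a b : Fin n} (h : a ≠ b) :
    hatA e a b = if e (edge a b h) then 1 else 0 := by
  rcases lt_or_gt_of_ne h with hab | hab
  · simp [hatA, edge, hab, min_eq_left hab.le, max_eq_right hab.le]
  · simp [hatA, edge, hab, not_lt.2 hab.le, min_eq_right hab.le, max_eq_left hab.le]

lemma hatA_apply_self (e : {q : Fin n × Fin n // q.1 < q.2} → Bool) (a : Fin n) :
    hatA e a a = 0 := by
  simp [hatA]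

lemma edge_eq_iff {a b c d : Fin n} (h : a ≠ b) (h' : c ≠ d) :
    edge a b h = edge c d h' ↔ a = c ∧ b = d ∨ a = d ∧ b = c := by
  simp only [edge, Subtype.mk.injEq, Prod.mk.injEq]
  grind

/-- The edges of the two-step paths from `i` to `j`, indexed by step and midpoint, are distinct. -/
lemma injective_pathEdges {i j : Fin n} (hij : i ≠ j) :
    Function.Injective (Sum.elim
      (fun k : {k : Fin n // i ≠ k ∧ k ≠ j} => edge i k.1 k.2.1)
      (fun k : {k : Fin n // i ≠ k ∧ k ≠ j} => edge k.1 j k.2.2)) := by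
  rintro (⟨k, hk⟩ | ⟨k, hk⟩) (⟨l, hl⟩ | ⟨l, hl⟩) h <;>
    simp only [Sum.elim_inl, Sum.elim_inr, edge_eq_iff] at h <;> grind

lemma mul_apply_eq_sum_midpoints {B : Matrix (Fin n) (Fin n) ℝ} (hB : ∀ k, B k k = 0)
    (i j : Fin n) :
    (B * B) i j = ∑ k : {k : Fin n // i ≠ k ∧ k ≠ j}, B i k * B k j := by
  rw [Matrix.mul_apply, ← Finset.sum_subtype (Finset.univ.filter fun k => i ≠ k ∧ k ≠ j)
    (by simp) fun k => B i k * B k j]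
  refine (Finset.sum_subset (Finset.filter_subset _ _) fun k _ hk => ?_).symm
  simp only [Finset.mem_filter, Finset.mem_univ, true_and, not_and_or, not_not] at hk
  rcases hk with rfl | rfl <;> simp [hB]

variable {A : Matrix (Fin n) (Fin n) ℝ} {γ : ℝ}

lemma isProbabilityMeasure_edgeMeasure (hp : ∀ a b, γ * A a b ∈ Set.Icc (0 : ℝ) 1) :
    IsProbabilityMeasure (edgeMeasure A γ) := by
  have := fun q : {q : Fin n × Fin n // q.1 < q.2} =>
    isProbabilityMeasure_bern (hp q.1.1 q.1.2)
  unfold edgeMeasure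
  infer_instance

lemma integral_hatA (hsymm : A.IsSymm) (hp : ∀ a b, γ * A a b ∈ Set.Icc (0 : ℝ) 1)
    {a b : Fin n} (h : a ≠ b) : ∫ e, hatA e a b ∂edgeMeasure A γ = γ * A a b := by
  have := fun q : {q : Fin n × Fin n // q.1 < q.2} =>
    isProbabilityMeasure_bern (hp q.1.1 q.1.2)
  simp_rw [hatA_apply_of_ne _ h]
  have hint := integral_comp_eval (i := edge a b h)
    (μ := fun q : {q : Fin n × Fin n // q.1 < q.2} => bern (γ * A q.1.1 q.1.2))
    (f := fun x : Bool => if x then (1 : ℝ) else 0)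
    (measurable_of_finite _).aestronglyMeasurable
  rw [integral_bern (hp _ _)] at hint
  refine hint.trans ?_
  rcases lt_or_gt_of_ne h with hab | hab
  · simp [edge, min_eq_left hab.le, max_eq_right hab.le]
  · simp [edge, min_eq_right hab.le, max_eq_left hab.le, hsymm.apply]

lemma iIndepFun_hatA_paths (hp : ∀ a b, γ * A a b ∈ Set.Icc (0 : ℝ) 1) {i j : Fin n}
    (hij : i ≠ j) :
    iIndepFun (Sum.elim (fun (k : {k : Fin n // i ≠ k ∧ k ≠ j}) e => hatA e i k)
      (fun (k : {k : Fin n // i ≠ k ∧ k ≠ j}) e => hatA e k j)) (edgeMeasure A γ) := by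
  have := fun q : {q : Fin n × Fin n // q.1 < q.2} =>
    isProbabilityMeasure_bern (hp q.1.1 q.1.2)
  have h := (iIndepFun_pi (μ := fun q : {q : Fin n × Fin n // q.1 < q.2} =>
    bern (γ * A q.1.1 q.1.2)) (X := fun _ x => if x then (1 : ℝ) else 0)
    (fun _ => by fun_prop)).precomp (injective_pathEdges hij)
  convert! h using 1
  ext (k | k) e
  · exact hatA_apply_of_ne e k.2.1
  · exact hatA_apply_of_ne e k.2.2

end Edges

/-- Entrywise concentration of the squared adjacency matrix under sparse edge
subsampling: for each fixed off-diagonal pair `(i, j)`,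
`P[|[A²]_{ij} − γ^{−2}·[Â²]_{ij}| ≥ 2τ·n^{3/2−α}] ≤ 2·e^{−τ²/(1+τ)}`. -/
theorem stmt15 (n : ℕ) (hn : 2 ≤ n) (α : ℝ) (hα1 : 1 / 2 ≤ α) (hα2 : α ≤ 1)
    (γ : ℝ) (hγ : γ = (n : ℝ) ^ (α - 1))
    (A : Matrix (Fin n) (Fin n) ℝ) (hsymm : A.IsSymm)
    (h01 : ∀ i j, A i j ∈ Set.Icc (0 : ℝ) 1) (hdiag : ∀ i, A i i = 0)
    (i j : Fin n) (hij : i ≠ j) (τ : ℝ) (hτ : 0 < τ) :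
    edgeMeasure A γ
        {e | 2 * τ * (n : ℝ) ^ ((3 : ℝ) / 2 - α) ≤
          |(A * A) i j - (γ ^ 2)⁻¹ * ((hatA e * hatA e) i j)|} ≤
      ENNReal.ofReal (2 * Real.exp (-(τ ^ 2) / (1 + τ))) := by
  have hn1 : (1 : ℝ) ≤ n := by exact_mod_cast (by omega : 1 ≤ n)
  have hn0 : (0 : ℝ) < n := by linarith
  have hγ0 : 0 < γ := hγ ▸ Real.rpow_pos_of_pos hn0 _
  have hγ1 : γ ≤ 1 := hγ ▸ Real.rpow_le_one_of_one_le_of_nonpos hn1 (by linarith)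
  have hp : ∀ a b, γ * A a b ∈ Set.Icc (0 : ℝ) 1 := fun a b =>
    ⟨mul_nonneg hγ0.le (h01 a b).1, mul_le_one₀ hγ1 (h01 a b).1 (h01 a b).2⟩
  have := isProbabilityMeasure_edgeMeasure hp
  set s : ℝ := (n : ℝ) ^ (α - 1 / 2) with hs
  have hγsq : γ ^ 2 = (n : ℝ) ^ (2 * α - 2) := by
    rw [hγ, ← Real.rpow_natCast, ← Real.rpow_mul hn0.le]
    congr 1
    push_cast
    ring
  have hscale : γ ^ 2 * (n : ℝ) ^ ((3 : ℝ) / 2 - α) = s := by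
    rw [hγsq, ← Real.rpow_add hn0, hs]
    congr 1
    ring
  have hssq : s ^ 2 = γ ^ 2 * n := by
    rw [hγsq, hs, ← Real.rpow_natCast, ← Real.rpow_mul hn0.le, ← Real.rpow_add_one hn0.ne']
    congr 1
    push_cast
    ring
  have hs1 : 1 ≤ s := Real.one_le_rpow hn1 (by linarith)
  have hAA : (A * A) i j ≤ n := by
    rw [Matrix.mul_apply]
    refine (Finset.sum_le_card_nsmul _ _ 1 fun k _ =>
      mul_le_one₀ (h01 i k).2 (h01 k j).1 (h01 k j).2).trans (by simp)
  have hind := iIndepFun_hatA_paths hp hij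
  have hval : ∀ (a b : Fin n) (e : {q : Fin n × Fin n // q.1 < q.2} → Bool), a ≠ b →
      hatA e a b = 0 ∨ hatA e a b = 1 := fun a b e h => by
    rw [hatA_apply_of_ne e h]
    split_ifs <;> simp
  have hmean : ∑ k : {k : Fin n // i ≠ k ∧ k ≠ j},
      (edgeMeasure A γ)[(fun e => hatA e i k) * fun e => hatA e k j] = γ ^ 2 * (A * A) i j := by
    rw [mul_apply_eq_sum_midpoints hdiag, Finset.mul_sum]
    refine Finset.sum_congr rfl fun k _ => ?_
    have hk : IndepFun (fun e => hatA e i k) (fun e => hatA e k j) (edgeMeasure A γ) :=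
      hind.indepFun (i := Sum.inl k) (j := Sum.inr k) (by simp)
    rw [hk.integral_mul_eq_mul_integral (measurable_of_finite _).aestronglyMeasurable
      (measurable_of_finite _).aestronglyMeasurable, integral_hatA hsymm hp k.2.1,
      integral_hatA hsymm hp k.2.2]
    ring
  have hmain := measureReal_abs_sub_ge_le (fun k => measurable_of_finite _)
    (fun k => measurable_of_finite _) hind (fun k e => hval i k e k.2.1)
    (fun k e => hval k j e k.2.2) hs1 hτ hmean
    (hssq ▸ mul_le_mul_of_nonneg_left hAA (sq_nonneg γ))
  rw [← ofReal_measureReal]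
  refine ENNReal.ofReal_le_ofReal (le_trans (measureReal_mono fun e he => ?_) hmain)
  simp only [Set.mem_ofPred_eq] at he ⊢
  rw [← mul_apply_eq_sum_midpoints (hatA_apply_self e), ← hscale]
  have hfac : γ ^ 2 * (A * A) i j - (hatA e * hatA e) i j =
      γ ^ 2 * ((A * A) i j - (γ ^ 2)⁻¹ * (hatA e * hatA e) i j) := by
    field_simp
  rw [hfac, abs_mul, abs_of_nonneg (sq_nonneg γ)]
  calc _ = γ ^ 2 * (2 * τ * (n : ℝ) ^ ((3 : ℝ) / 2 - α)) := by ring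
    _ ≤ _ := mul_le_mul_of_nonneg_left he (sq_nonneg γ)
end

section
/- There is an absolute constant c > 0 with the following property. Let n ≥ 2, let k satisfy 3 ≤ k ≤ √n, let α ∈ (1/2, 1], γ = n^{α−1}, d ∈ (0, 1], and 0 < τ ≤ d·n^{α/2}/4. Let A be a (deterministic) symmetric n×n matrix with entries in [0,1], zero diagonal, and degree matrix D (diagonal, D_{ii} = Σ_j A_{ij}) with D_{ii} ≥ n·d for all i, and set P = D^{−1}A. Let Â be a random symmetric n×n matrix whose entries Â_{ij} = Â_{ji} for i < j are independent Bernoulli random variables with success probabilities γ·A_{ij}, with Â_{ii} = 0 and degree matrix D̂. Then with probability at least 1 − c·k·n²·e^{−τ²/(1+τ)}: D̂ is invertible and, with P̂ = D̂^{−1}Â, max_{i,j} n·|[P^k]_{ij} − [P̂^k]_{ij}| ≤ (n^{−α/2} + n^{1/2−α})·4^{k+1}·d^{−(k+1)}·(1+τ)·τ. -/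
open MeasureTheory

/-- All absolute row sums of `M` are at most `c`. -/
def RowBdd {n : ℕ} (M : Matrix (Fin n) (Fin n) ℝ) (c : ℝ) : Prop :=
  ∀ i, ∑ j, |M i j| ≤ c

/-- The absolute column sums of `M`, weighted by `w`, are at most `c` times the weight. -/
def ColBdd {n : ℕ} (w : Fin n → ℝ) (M : Matrix (Fin n) (Fin n) ℝ) (c : ℝ) : Prop :=
  ∀ j, ∑ i, w i * |M i j| ≤ c * w j

/-- The entries of `M` are bounded by `c` times the weight of their column. -/
def EntBdd {n : ℕ} (w : Fin n → ℝ) (M : Matrix (Fin n) (Fin n) ℝ) (c : ℝ) : Prop :=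
  ∀ i j, |M i j| ≤ c * w j

section Bounds

variable {n : ℕ} {w : Fin n → ℝ} {M R : Matrix (Fin n) (Fin n) ℝ} {a b : ℝ}

lemma abs_mul_apply_le (M R : Matrix (Fin n) (Fin n) ℝ) (i j : Fin n) :
    |(M * R) i j| ≤ ∑ l, |M i l| * |R l j| := by
  rw [Matrix.mul_apply]
  exact (Finset.abs_sum_le_sum_abs _ _).trans_eq (by simp only [abs_mul])

lemma RowBdd.mul (hM : RowBdd M a) (hR : RowBdd R b) (hb : 0 ≤ b) : RowBdd (M * R) (a * b) := by
  intro i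
  calc ∑ j, |(M * R) i j| ≤ ∑ j, ∑ l, |M i l| * |R l j| :=
        Finset.sum_le_sum fun j _ => abs_mul_apply_le M R i j
    _ = ∑ l, |M i l| * ∑ j, |R l j| := by
        rw [Finset.sum_comm]; simp only [Finset.mul_sum]
    _ ≤ ∑ l, |M i l| * b := by gcongr with l; exact hR l
    _ ≤ a * b := by rw [← Finset.sum_mul]; gcongr; exact hM i

lemma RowBdd.one : RowBdd (1 : Matrix (Fin n) (Fin n) ℝ) 1 := by
  intro i
  simp [Matrix.one_apply, apply_ite]

lemma RowBdd.pow (hM : RowBdd M a) (ha : 0 ≤ a) : ∀ m : ℕ, RowBdd (M ^ m) (a ^ m)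
  | 0 => by simpa using RowBdd.one
  | m + 1 => by
    rw [pow_succ, pow_succ]
    exact (RowBdd.pow hM ha m).mul hM ha

lemma ColBdd.mul (hM : ColBdd w M a) (hR : ColBdd w R b) (ha : 0 ≤ a) (hw : ∀ i, 0 ≤ w i) :
    ColBdd w (M * R) (a * b) := by
  intro j
  calc ∑ i, w i * |(M * R) i j| ≤ ∑ i, w i * ∑ l, |M i l| * |R l j| := by
        gcongr with i
        · exact hw i
        · exact abs_mul_apply_le M R i j
    _ = ∑ l, (∑ i, w i * |M i l|) * |R l j| := by
        simp only [Finset.mul_sum, Finset.sum_mul]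
        rw [Finset.sum_comm]
        simp only [mul_assoc]
    _ ≤ ∑ l, a * w l * |R l j| := by gcongr with l; exact hM l
    _ = a * ∑ l, w l * |R l j| := by simp only [Finset.mul_sum, mul_assoc]
    _ ≤ a * (b * w j) := by gcongr; exact hR j
    _ = a * b * w j := by ring

lemma ColBdd.one : ColBdd w (1 : Matrix (Fin n) (Fin n) ℝ) 1 := by
  intro i
  simp [Matrix.one_apply, apply_ite]

lemma ColBdd.pow (hM : ColBdd w M a) (ha : 0 ≤ a) (hw : ∀ i, 0 ≤ w i) :
    ∀ m : ℕ, ColBdd w (M ^ m) (a ^ m)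
  | 0 => by simpa using ColBdd.one
  | m + 1 => by
    rw [pow_succ, pow_succ]
    exact (ColBdd.pow hM ha hw m).mul hM (by positivity) hw

lemma RowBdd.mul_entBdd (hM : RowBdd M a) (hR : EntBdd w R b) (hb : 0 ≤ b) (hw : ∀ i, 0 ≤ w i) :
    EntBdd w (M * R) (a * b) := by
  intro i j
  have := hw j
  calc |(M * R) i j| ≤ ∑ l, |M i l| * |R l j| := abs_mul_apply_le M R i j
    _ ≤ ∑ l, |M i l| * (b * w j) := by gcongr with l; exact hR l j
    _ ≤ a * (b * w j) := by rw [← Finset.sum_mul]; gcongr; exact hM i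
    _ = a * b * w j := by ring

lemma EntBdd.mul_colBdd (hM : EntBdd w M a) (hR : ColBdd w R b) (ha : 0 ≤ a) :
    EntBdd w (M * R) (a * b) := by
  intro i j
  calc |(M * R) i j| ≤ ∑ l, |M i l| * |R l j| := abs_mul_apply_le M R i j
    _ ≤ ∑ l, a * w l * |R l j| := by gcongr with l; exact hM i l
    _ = a * ∑ l, w l * |R l j| := by simp only [Finset.mul_sum, mul_assoc]
    _ ≤ a * (b * w j) := by gcongr; exact hR j
    _ = a * b * w j := by ring

lemma EntBdd.add (hM : EntBdd w M a) (hR : EntBdd w R b) : EntBdd w (M + R) (a + b) := by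
  intro i j
  rw [add_mul]
  exact (abs_add_le _ _).trans (add_le_add (hM i j) (hR i j))

lemma RowBdd.sub (hM : RowBdd M a) (hR : RowBdd R b) : RowBdd (M - R) (a + b) := by
  intro i
  refine le_trans ?_ (add_le_add (hM i) (hR i))
  rw [← Finset.sum_add_distrib]
  exact Finset.sum_le_sum fun j _ => abs_sub _ _

lemma ColBdd.sub (hM : ColBdd w M a) (hR : ColBdd w R b) (hw : ∀ i, 0 ≤ w i) :
    ColBdd w (M - R) (a + b) := by
  intro j
  rw [add_mul]
  refine le_trans ?_ (add_le_add (hM j) (hR j))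
  rw [← Finset.sum_add_distrib]
  refine Finset.sum_le_sum fun i _ => ?_
  rw [← mul_add]
  exact mul_le_mul_of_nonneg_left (abs_sub _ _) (hw i)

/-- If `Q` has row sums at most `2` and `(Q - P) P ^ l` is entrywise small, so is
`Q ^ m P - P ^ (m + 1)`. -/
lemma entBdd_pow_mul_sub_pow {Q P : Matrix (Fin n) (Fin n) ℝ} {e : ℝ} (he : 0 ≤ e)
    (hw : ∀ i, 0 ≤ w i) (hQ : RowBdd Q 2) (m : ℕ)
    (hB : ∀ l, 1 ≤ l → l ≤ m → EntBdd w ((Q - P) * P ^ l) e) :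
    EntBdd w (Q ^ m * P - P ^ (m + 1)) ((2 ^ m - 1) * e) := by
  induction m with
  | zero => intro i j; simp
  | succ m ih =>
    have h1 := hQ.mul_entBdd (ih fun l h1 h2 => hB l h1 (by lia))
      (mul_nonneg (by linarith [one_le_pow₀ (n := m) (one_le_two (α := ℝ))]) he) hw
    have h2 := h1.add (hB (m + 1) (by lia) le_rfl)
    have e1 : Q ^ (m + 1) * P - P ^ (m + 1 + 1) =
        Q * (Q ^ m * P - P ^ (m + 1)) + (Q - P) * P ^ (m + 1) := by
      rw [pow_succ' Q m, pow_succ' P (m + 1)]; noncomm_ring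
    rw [e1]
    convert h2 using 1
    ring

/-- If `Q` has weighted column sums at most `2` and `P ^ l (Q - P)` is entrywise small, so is
`P Q ^ m - P ^ (m + 1)`. -/
lemma entBdd_mul_pow_sub_pow {Q P : Matrix (Fin n) (Fin n) ℝ} {e : ℝ} (he : 0 ≤ e)
    (hQ : ColBdd w Q 2) (m : ℕ)
    (hB : ∀ l, 1 ≤ l → l ≤ m → EntBdd w (P ^ l * (Q - P)) e) :
    EntBdd w (P * Q ^ m - P ^ (m + 1)) ((2 ^ m - 1) * e) := by
  induction m with
  | zero => intro i j; simp
  | succ m ih =>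
    have h1 := (ih fun l h1 h2 => hB l h1 (by lia)).mul_colBdd hQ
      (mul_nonneg (by linarith [one_le_pow₀ (n := m) (one_le_two (α := ℝ))]) he)
    have h2 := h1.add (hB (m + 1) (by lia) le_rfl)
    have e1 : P * Q ^ (m + 1) - P ^ (m + 1 + 1) =
        (P * Q ^ m - P ^ (m + 1)) * Q + P ^ (m + 1) * (Q - P) := by
      rw [pow_succ Q m, pow_succ P (m + 1)]; noncomm_ring
    rw [e1]
    convert h2 using 1
    ring

lemma pow_apply_nonneg (hM : ∀ i j, 0 ≤ M i j) : ∀ (m : ℕ) (i j : Fin n), 0 ≤ (M ^ m) i j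
  | 0, i, j => by rw [pow_zero, Matrix.one_apply]; split_ifs <;> norm_num
  | m + 1, i, j => by
    rw [pow_succ, Matrix.mul_apply]
    exact Finset.sum_nonneg fun l _ => mul_nonneg (pow_apply_nonneg hM m i l) (hM l j)

/-- Rescaling the rows of a nonnegative matrix by factors within `ε` of `1` changes the entries of
its `k`-th power by a relative error of at most `(1 + ε) ^ k - 1`. -/
lemma abs_pow_sub_pow_le_of_row_scaling (hM : ∀ i j, 0 ≤ M i j) {s : Fin n → ℝ} {ε : ℝ}
    (hs : ∀ i, |s i - 1| ≤ ε) (hR : ∀ i j, R i j = s i * M i j) (k : ℕ) :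
    ∀ i j, |(R ^ k) i j - (M ^ k) i j| ≤ ((1 + ε) ^ k - 1) * (M ^ k) i j := by
  induction k with
  | zero => intro i j; simp
  | succ k ih =>
    intro i j
    have hp := pow_apply_nonneg hM k
    have hs' : ∀ l, |s l| ≤ 1 + ε := fun l => by
      have := abs_le.1 (hs l)
      rw [abs_le]; constructor <;> linarith
    rw [pow_succ R, pow_succ M, Matrix.mul_apply, Matrix.mul_apply, ← Finset.sum_sub_distrib,
      Finset.mul_sum]
    refine (Finset.abs_sum_le_sum_abs _ _).trans (Finset.sum_le_sum fun l _ => ?_)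
    have h1 : (R ^ k) i l * R l j - (M ^ k) i l * M l j =
        (((R ^ k) i l - (M ^ k) i l) * s l + (M ^ k) i l * (s l - 1)) * M l j := by
      rw [hR]; ring
    rw [h1, abs_mul, abs_of_nonneg (hM l j), ← mul_assoc]
    refine mul_le_mul_of_nonneg_right ?_ (hM l j)
    refine (abs_add_le _ _).trans ?_
    rw [abs_mul, abs_mul, abs_of_nonneg (hp i l)]
    have h2 := mul_le_mul (ih i l) (hs' l) (abs_nonneg _) ((abs_nonneg _).trans (ih i l))
    have h3 := mul_le_mul_of_nonneg_left (hs l) (hp i l)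
    refine (add_le_add h2 h3).trans_eq ?_
    ring

end Bounds

lemma one_add_pow_sub_one_le {ε : ℝ} (h0 : 0 ≤ ε) (h1 : ε ≤ 1) (k : ℕ) :
    (1 + ε) ^ k - 1 ≤ ε * 2 ^ k := by
  suffices h : (1 + ε) ^ k - 1 ≤ ε * (2 ^ k - 1) by linarith
  induction k with
  | zero => simp
  | succ k ih =>
    have h2 : (1 + ε) ^ k ≤ 2 ^ k := by gcongr; linarith
    rw [pow_succ, pow_succ]
    nlinarith

/-- Entrywise comparison of `Q ^ k` and `P ^ k` for `k ≥ 3`, using entrywise control of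
`(Q - P) P ^ l`, `P ^ l (Q - P)` and the off-diagonal part of `(Q - P) ^ 2`. -/
lemma entBdd_pow_sub_pow {n : ℕ} {P Q : Matrix (Fin n) (Fin n) ℝ} {D : Fin n → ℝ}
    {N d e e' h : ℝ} {m : ℕ} (hN : 0 < N) (hd : 0 < d) (he : 0 ≤ e) (he' : 0 ≤ e') (hh : 0 ≤ h)
    (hD : ∀ i, N * d ≤ D i) (hDN : ∀ i, D i ≤ N)
    (hPr : RowBdd P 1) (hQr : RowBdd Q 2) (hPc : ColBdd D P 1) (hQc : ColBdd D Q 2)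
    (hBP : ∀ l, 1 ≤ l → l ≤ m + 2 → EntBdd (fun _ => 1) ((Q - P) * P ^ l) e)
    (hPB : ∀ l, 1 ≤ l → l ≤ m + 2 → EntBdd (fun _ => 1) (P ^ l * (Q - P)) e)
    (hB : EntBdd (fun _ => 1) (Q - P) h)
    (hBB : ∀ i j, i ≠ j → |((Q - P) * (Q - P)) i j| ≤ e') :
    ∀ i j, |(Q ^ (m + 3)) i j - (P ^ (m + 3)) i j| ≤
      2 ^ m * (10 * (e / d) + 4 * e + 3 * h ^ 2 + 3 * (e' / d)) := by
  intro i j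
  have hNd : 0 < N * d := by positivity
  have hDpos : ∀ i, 0 ≤ D i := fun i => hNd.le.trans (hD i)
  have hw1 : ∀ i : Fin n, (0 : ℝ) ≤ (fun _ => 1 : Fin n → ℝ) i := fun _ => zero_le_one
  have toD : ∀ M : Matrix (Fin n) (Fin n) ℝ,
      EntBdd (fun _ => 1) M e → EntBdd D M (e / (N * d)) := fun M hM a b => by
    refine (hM a b).trans ?_
    rw [div_mul_eq_mul_div, le_div_iff₀ hNd, mul_one]
    exact mul_le_mul_of_nonneg_left (hD b) he
  have hf : 0 ≤ e / (N * d) := by positivity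
  have hBr : RowBdd (Q - P) 3 := by
    convert hQr.sub hPr using 1; norm_num
  have hBc : ColBdd D (Q - P) 3 := by
    convert hQc.sub hPc hDpos using 1; norm_num
  have hRc : ColBdd D (Q ^ m * (Q - P)) (2 ^ m * 3) :=
    (hQc.pow zero_le_two hDpos m).mul hBc (by positivity) hDpos
  have hRe : EntBdd (fun _ => 1) (Q ^ m * (Q - P)) (2 ^ m * h) :=
    (hQr.pow zero_le_two m).mul_entBdd hB hh hw1
  have hpow : (1 : ℝ) ≤ 2 ^ m := one_le_pow₀ one_le_two
  have t1 := entBdd_pow_mul_sub_pow he hw1 hQr (m + 2) hBP i j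
  have t2 := ((entBdd_mul_pow_sub_pow hf hQc (m + 1)
    fun l h1 h2 => toD _ (hPB l h1 (by lia))).mul_colBdd hBc
      (mul_nonneg (by linarith [one_le_pow₀ (n := m + 1) (one_le_two (α := ℝ))]) hf)) i j
  have t3 := toD _ (hPB (m + 2) (by lia) le_rfl) i j
  have t4 := ((toD _ (hBP 1 le_rfl (by lia))).mul_colBdd hRc hf) i j
  have t5 : |((Q - P) * (Q - P) * (Q ^ m * (Q - P))) i j| ≤
      2 ^ m * (3 * h ^ 2) + 2 ^ m * (3 * (e' / d)) := by
    refine (abs_mul_apply_le _ _ i j).trans ?_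
    rw [← Finset.add_sum_erase _ _ (Finset.mem_univ i)]
    refine add_le_add ?_ ?_
    · have h1 := (hBr.mul_entBdd hB hh hw1) i i
      have h2 := hRe i j
      refine (mul_le_mul h1 h2 (abs_nonneg _) (by positivity)).trans_eq ?_
      ring
    · have h1 : ∑ l ∈ Finset.univ.erase i,
          |((Q - P) * (Q - P)) i l| * |(Q ^ m * (Q - P)) l j| ≤
          ∑ l ∈ Finset.univ.erase i, e' / (N * d) * (D l * |(Q ^ m * (Q - P)) l j|) := by
        refine Finset.sum_le_sum fun l hl => ?_
        rw [← mul_assoc]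
        refine mul_le_mul_of_nonneg_right ?_ (abs_nonneg _)
        refine (hBB i l (Finset.ne_of_mem_erase hl).symm).trans ?_
        rw [div_mul_eq_mul_div, le_div_iff₀ hNd]
        exact mul_le_mul_of_nonneg_left (hD l) he'
      have h2 : ∑ l ∈ Finset.univ.erase i, e' / (N * d) * (D l * |(Q ^ m * (Q - P)) l j|) ≤
          ∑ l, e' / (N * d) * (D l * |(Q ^ m * (Q - P)) l j|) :=
        Finset.sum_le_sum_of_subset_of_nonneg (Finset.erase_subset _ _) fun l _ _ =>
          mul_nonneg (by positivity) (mul_nonneg (hDpos l) (abs_nonneg _))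
      refine (h1.trans h2).trans ?_
      rw [← Finset.mul_sum]
      calc e' / (N * d) * ∑ l, D l * |(Q ^ m * (Q - P)) l j|
          ≤ e' / (N * d) * (2 ^ m * 3 * N) := by
            gcongr
            exact (hRc j).trans (by gcongr; exact hDN j)
        _ = 2 ^ m * (3 * (e' / d)) := by field_simp
  have hDe : e / (N * d) * D j ≤ e / d := by
    calc e / (N * d) * D j ≤ e / (N * d) * N := by gcongr; exact hDN j
      _ = e / d := by field_simp
  have hDe0 : 0 ≤ e / (N * d) * D j := mul_nonneg hf (hDpos j)
  have hsplit : Q ^ (m + 3) - P ^ (m + 3) =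
      (Q ^ (m + 2) * P - P ^ (m + 2 + 1)) + (P * Q ^ (m + 1) - P ^ (m + 1 + 1)) * (Q - P)
      + P ^ (m + 2) * (Q - P) + (Q - P) * P ^ 1 * (Q ^ m * (Q - P))
      + (Q - P) * (Q - P) * (Q ^ m * (Q - P)) := by
    have e1 : Q ^ (m + 1) = Q * Q ^ m := pow_succ' Q m
    have e2 : Q ^ (m + 2) = Q * (Q * Q ^ m) := by rw [pow_succ', pow_succ']
    have e3 : Q ^ (m + 3) = Q * (Q * Q ^ m) * Q := by rw [pow_succ, pow_succ', pow_succ']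
    rw [e1, e2, e3, pow_one]
    noncomm_ring
  rw [← Matrix.sub_apply, hsplit]
  simp only [Matrix.add_apply]
  refine (abs_add_le _ _).trans ?_
  refine (add_le_add_left ((abs_add_le _ _).trans (add_le_add_left ((abs_add_le _ _).trans
    (add_le_add_left (abs_add_le _ _) _)) _)) _).trans ?_
  set x := e / (N * d) * D j
  have b1 : |(Q ^ (m + 2) * P - P ^ (m + 2 + 1)) i j| ≤ 2 ^ m * (4 * e) := by
    refine t1.trans ?_
    rw [pow_add]; nlinarith
  have b2 : |((P * Q ^ (m + 1) - P ^ (m + 1 + 1)) * (Q - P)) i j| ≤ 2 ^ m * (6 * (e / d)) := by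
    refine t2.trans ?_
    calc (2 ^ (m + 1) - 1) * (e / (N * d)) * 3 * D j = (2 ^ (m + 1) - 1) * 3 * x := by ring
      _ ≤ 2 ^ m * (6 * x) := by rw [pow_succ]; nlinarith
      _ ≤ _ := by gcongr
  have b3 : |(P ^ (m + 2) * (Q - P)) i j| ≤ 2 ^ m * (e / d) := by
    refine t3.trans (hDe.trans (le_mul_of_one_le_left (by positivity) hpow))
  have b4 : |((Q - P) * P ^ 1 * (Q ^ m * (Q - P))) i j| ≤ 2 ^ m * (3 * (e / d)) := by
    refine t4.trans ?_
    calc e / (N * d) * (2 ^ m * 3) * D j = 2 ^ m * (3 * x) := by ring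
      _ ≤ _ := by gcongr
  linarith

lemma weight_mul_transition_pow {n : ℕ} {P : Matrix (Fin n) (Fin n) ℝ} {D : Fin n → ℝ}
    (h : ∀ i j, D i * P i j = D j * P j i) :
    ∀ (m : ℕ) (i j : Fin n), D i * (P ^ m) i j = D j * (P ^ m) j i
  | 0, i, j => by
    rw [pow_zero, Matrix.one_apply, Matrix.one_apply]
    by_cases hij : i = j
    · rw [hij]
    · simp [hij, Ne.symm hij]
  | m + 1, i, j => by
    rw [pow_succ' P m, Matrix.mul_apply, ← pow_succ' P m, pow_succ P m, Matrix.mul_apply,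
      Finset.mul_sum, Finset.mul_sum]
    refine Finset.sum_congr rfl fun l _ => ?_
    rw [← mul_assoc, h i l, ← mul_assoc, ← weight_mul_transition_pow h m l j]
    ring

set_option maxHeartbeats 1000000 in
/-- Deterministic comparison of the powers of two transition matrices: if the degrees, the products
`(H - g A) P ^ l` and the off-diagonal entries of `(H - g A) D⁻¹ (H - g A)` deviate little from
zero, the powers of the two transition matrices are entrywise close. -/
lemma transition_pow_close {n m : ℕ} {A H : Matrix (Fin n) (Fin n) ℝ} {N d g τ s r : ℝ}
    (hA : A.IsSymm) (hH : H.IsSymm) (hA01 : ∀ i j, A i j ∈ Set.Icc (0 : ℝ) 1)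
    (hH01 : ∀ i j, H i j ∈ Set.Icc (0 : ℝ) 1)
    (hN : 0 < N) (hd : 0 < d) (hd1 : d ≤ 1) (hg : 0 < g) (hg1 : g ≤ 1) (hs : 0 < s) (hr : 1 ≤ r)
    (hτ : 1 ≤ τ) (hs2 : s ^ 2 = g * N) (hr2 : r ^ 2 = g ^ 2 * N) (hτs : τ ≤ d * s / 4)
    (hD : ∀ i, N * d ≤ ∑ l, A i l) (hDN : ∀ i, ∑ l, A i l ≤ N)
    (hdeg : ∀ i, |∑ l, (H i l - g * A i l)| ≤ τ * s)
    (hpow : ∀ l i j, 1 ≤ l → l ≤ m + 2 → |∑ a, (H i a - g * A i a) *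
      (N * d * ((Matrix.of fun i' j' : Fin n => A i' j' / ∑ l, A i' l) ^ l) a j)| ≤ τ * s)
    (hsq : ∀ i j, i ≠ j → |∑ a, (H i a - g * A i a) * (H a j - g * A a j) *
      (N * d / ∑ l, A a l)| ≤ τ * r) :
    (∀ i, 0 < ∑ l, H i l) ∧ ∀ i j : Fin n,
      N * |((Matrix.of fun i' j' : Fin n => A i' j' / ∑ l, A i' l) ^ (m + 3)) i j -
        ((Matrix.of fun i' j' : Fin n => H i' j' / ∑ l, H i' l) ^ (m + 3)) i j| ≤
      (1 / s + 1 / r) * 4 ^ (m + 4) * (d ^ 3)⁻¹ * τ := by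
  set P : Matrix (Fin n) (Fin n) ℝ := Matrix.of fun i' j' : Fin n => A i' j' / ∑ l, A i' l with hP
  set D : Fin n → ℝ := fun i => ∑ l, A i l with hDdef
  set Q : Matrix (Fin n) (Fin n) ℝ := Matrix.of fun i j => H i j / (g * D i) with hQ
  have hNd : 0 < N * d := by positivity
  have hr0 : 0 < r := by linarith
  have hτ0 : 0 < τ := by linarith
  have hDp : ∀ i, 0 < D i := fun i => hNd.trans_le (hD i)
  have hD0 : ∀ i, 0 ≤ D i := fun i => (hDp i).le
  have hAs : ∀ i j, A i j = A j i := fun i j => hA.apply j i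
  have hHs : ∀ i j, H i j = H j i := fun i j => hH.apply j i
  have hPij : ∀ i j, P i j = A i j / D i := fun i j => rfl
  have hQij : ∀ i j, Q i j = H i j / (g * D i) := fun i j => rfl
  have hP0 : ∀ i j, 0 ≤ P i j := fun i j => div_nonneg (hA01 i j).1 (hD0 i)
  have hQ0 : ∀ i j, 0 ≤ Q i j := fun i j =>
    div_nonneg (hH01 i j).1 (mul_nonneg hg.le (hD0 i))
  have hBij : ∀ i j, (Q - P) i j = (H i j - g * A i j) / (g * D i) := fun i j => by
    have := hDp i
    rw [Matrix.sub_apply, hPij, hQij]; field_simp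
  -- degrees
  have hδ : τ * s ≤ g * (N * d) / 4 := by nlinarith
  have hdeg' : ∀ i, |∑ l, H i l - g * D i| ≤ τ * s := fun i => by
    have := hdeg i
    rwa [Finset.sum_sub_distrib, ← Finset.mul_sum] at this
  have hgD : ∀ i, g * (N * d) ≤ g * D i := fun i => mul_le_mul_of_nonneg_left (hD i) hg.le
  have hgDp : ∀ i, 0 < g * D i := fun i => mul_pos hg (hDp i)
  have hHlow : ∀ i, 3 / 4 * (g * D i) ≤ ∑ l, H i l := fun i => by
    linarith [(abs_le.1 (hdeg' i)).1, hgD i]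
  have hHup : ∀ i, ∑ l, H i l ≤ 2 * (g * D i) := fun i => by
    linarith [(abs_le.1 (hdeg' i)).2, hgD i, hgDp i]
  have hHpos : ∀ i, 0 < ∑ l, H i l := fun i => by linarith [hHlow i, hgDp i]
  -- row and column bounds
  have hPr : RowBdd P 1 := fun i => by
    have : ∀ j, |P i j| = A i j / D i := fun j => abs_of_nonneg (hP0 i j)
    simp only [this, ← Finset.sum_div]
    exact (div_self (hDp i).ne').le
  have hQr : RowBdd Q 2 := fun i => by
    have : ∀ j, |Q i j| = H i j / (g * D i) := fun j => abs_of_nonneg (hQ0 i j)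
    simp only [this, ← Finset.sum_div]
    rw [div_le_iff₀ (hgDp i)]
    exact hHup i
  have hPc : ColBdd D P 1 := fun j => by
    have : ∀ i, D i * |P i j| = A j i := fun i => by
      have := hDp i
      rw [abs_of_nonneg (hP0 _ _), hPij, hAs j i]; field_simp
    simp only [this, one_mul]
    exact le_rfl
  have hQc : ColBdd D Q 2 := fun j => by
    have : ∀ i, D i * |Q i j| = H j i / g := fun i => by
      have := hDp i
      rw [abs_of_nonneg (hQ0 _ _), hQij, hHs j i]; field_simp
    simp only [this, ← Finset.sum_div]
    rw [div_le_iff₀ hg]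
    linarith [hHup j]
  -- entrywise bounds
  have hdivle : ∀ {x b : ℝ} (i : Fin n), N * d * |x| ≤ b →
      |x / (g * D i)| ≤ b / (N * d) / (g * (N * d)) := fun {x b} i hx => by
    rw [abs_div, abs_of_pos (hgDp i)]
    have hb : 0 ≤ b := le_trans (by positivity) hx
    refine div_le_div₀ (by positivity) ?_ (by positivity) (hgD i)
    rw [le_div_iff₀ hNd]
    linarith
  set e : ℝ := τ * s / (N * d) / (g * (N * d)) with he
  have hEP : ∀ l i j, 1 ≤ l → l ≤ m + 2 →
      N * d * |∑ a, (H i a - g * A i a) * (P ^ l) a j| ≤ τ * s := fun l i j h1 h2 => by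
    have := hpow l i j h1 h2
    rw [← abs_of_pos hNd, ← abs_mul, Finset.mul_sum]
    refine le_of_eq_of_le ?_ this
    congr 1
    exact Finset.sum_congr rfl fun a _ => by ring
  have hBP : ∀ l, 1 ≤ l → l ≤ m + 2 → EntBdd (fun _ => 1) ((Q - P) * P ^ l) e := by
    intro l h1 h2 i j
    have : ((Q - P) * P ^ l) i j = (∑ a, (H i a - g * A i a) * (P ^ l) a j) / (g * D i) := by
      rw [Matrix.mul_apply, Finset.sum_div]
      exact Finset.sum_congr rfl fun a _ => by rw [hBij]; ring
    rw [this, mul_one]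
    exact hdivle i (hEP l i j h1 h2)
  have hrev : ∀ i j, D i * P i j = D j * P j i := fun i j => by
    have := hDp i
    have := hDp j
    rw [hPij, hPij, hAs i j]; field_simp
  have hPB : ∀ l, 1 ≤ l → l ≤ m + 2 → EntBdd (fun _ => 1) (P ^ l * (Q - P)) e := by
    intro l h1 h2 i j
    have : (P ^ l * (Q - P)) i j = (∑ a, (H j a - g * A j a) * (P ^ l) a i) / (g * D i) := by
      rw [Matrix.mul_apply, Finset.sum_div]
      refine Finset.sum_congr rfl fun a _ => ?_
      have ha := hDp a
      have hi := hDp i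
      have h3 : (P ^ l) i a = D a * (P ^ l) a i / D i := by
        rw [← weight_mul_transition_pow hrev l i a]; field_simp
      rw [hBij, h3, hHs a j, hAs a j]
      field_simp
    rw [this, mul_one]
    exact hdivle i (hEP l j i h1 h2)
  have hEle : ∀ i j, |H i j - g * A i j| ≤ 1 := fun i j => by
    have h1 := hA01 i j
    have h2 := hH01 i j
    have h3 : 0 ≤ g * A i j := mul_nonneg hg.le h1.1
    have h4 : g * A i j ≤ 1 := mul_le_one₀ hg1 h1.1 h1.2
    rw [abs_le]; constructor <;> linarith [h2.1, h2.2]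
  have hB : EntBdd (fun _ => 1) (Q - P) (1 / (g * (N * d))) := fun i j => by
    rw [hBij, mul_one, abs_div, abs_of_pos (hgDp i)]
    exact div_le_div₀ zero_le_one (hEle i j) (by positivity) (hgD i)
  have hBB : ∀ i j, i ≠ j → |((Q - P) * (Q - P)) i j| ≤
      τ * r / (N * d) / g / (g * (N * d)) := by
    intro i j hij
    have : ((Q - P) * (Q - P)) i j =
        (∑ a, (H i a - g * A i a) * (H a j - g * A a j) / D a) / g / (g * D i) := by
      rw [Matrix.mul_apply, Finset.sum_div, Finset.sum_div]
      refine Finset.sum_congr rfl fun a _ => ?_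
      have ha := hDp a
      have hi := hDp i
      rw [hBij, hBij]
      field_simp
    have hx : N * d * |(∑ a, (H i a - g * A i a) * (H a j - g * A a j) / D a) / g| ≤
        τ * r / g := by
      rw [abs_div, abs_of_pos hg, ← mul_div_assoc]
      refine div_le_div_of_nonneg_right ?_ hg.le
      refine le_of_eq_of_le ?_ (hsq i j hij)
      conv_lhs => rw [← abs_of_pos hNd]
      rw [← abs_mul, Finset.mul_sum]
      congr 1
      exact Finset.sum_congr rfl fun a _ => by ring
    rw [this]
    exact (hdivle i hx).trans_eq (by ring)
  have hQP := entBdd_pow_sub_pow hN hd (by positivity) (by positivity) (by positivity) hD hDN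
    hPr hQr hPc hQc hBP hPB hB hBB
  refine ⟨hHpos, fun i j => ?_⟩
  -- collecting the error terms of the comparison of `Q` and `P`
  set x := τ / s with hx
  set y := τ / r with hy
  have hx0 : 0 < x := by positivity
  have hy0 : 0 < y := by positivity
  have hd3 : (d ^ 2)⁻¹ ≤ (d ^ 3)⁻¹ := by
    have : d ^ 3 ≤ d ^ 2 := pow_le_pow_of_le_one hd.le hd1 (by norm_num)
    gcongr
  have hη : N * |(Q ^ (m + 3)) i j - (P ^ (m + 3)) i j| ≤ 2 * 2 ^ (m + 3) * ((d ^ 3)⁻¹ * (x + y)) := by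
    have hNe : N * e = (d ^ 2)⁻¹ * x := by
      have : N = s ^ 2 / g := by rw [hs2]; field_simp
      rw [he, hx, this]; field_simp
    have hNe' : N * (τ * r / (N * d) / g / (g * (N * d))) = (d ^ 2)⁻¹ * y := by
      have : N = r ^ 2 / g ^ 2 := by rw [hr2]; field_simp
      rw [hy, this]; field_simp
    have hNh : N * (1 / (g * (N * d))) ^ 2 ≤ (d ^ 2)⁻¹ * y := by
      have : N = r ^ 2 / g ^ 2 := by rw [hr2]; field_simp
      have h1 : N * (1 / (g * (N * d))) ^ 2 = (d ^ 2)⁻¹ * (1 / r ^ 2) := by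
        rw [this]; field_simp
      rw [h1, hy]
      refine mul_le_mul_of_nonneg_left ?_ (by positivity)
      refine div_le_div₀ hτ0.le hτ hr0 ?_
      nlinarith
    have hdd : (d ^ 2)⁻¹ / d = (d ^ 3)⁻¹ := by field_simp
    calc N * |(Q ^ (m + 3)) i j - (P ^ (m + 3)) i j|
        ≤ N * (2 ^ m * (10 * (e / d) + 4 * e + 3 * (1 / (g * (N * d))) ^ 2
            + 3 * (τ * r / (N * d) / g / (g * (N * d)) / d))) :=
          mul_le_mul_of_nonneg_left (hQP i j) hN.le
      _ = 2 ^ m * (10 * ((N * e) / d) + 4 * (N * e) + 3 * (N * (1 / (g * (N * d))) ^ 2)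
            + 3 * ((N * (τ * r / (N * d) / g / (g * (N * d)))) / d)) := by ring
      _ ≤ 2 ^ m * (10 * ((d ^ 3)⁻¹ * x) + 4 * ((d ^ 3)⁻¹ * x) + 3 * ((d ^ 3)⁻¹ * y)
            + 3 * ((d ^ 3)⁻¹ * y)) := by
          rw [hNe, hNe', mul_div_right_comm, mul_div_right_comm, hdd]
          have h5 : (d ^ 2)⁻¹ * x ≤ (d ^ 3)⁻¹ * x := by gcongr
          have h6 : (d ^ 2)⁻¹ * y ≤ (d ^ 3)⁻¹ * y := by gcongr
          refine mul_le_mul_of_nonneg_left ?_ (by positivity)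
          linarith
      _ ≤ 2 * 2 ^ (m + 3) * ((d ^ 3)⁻¹ * (x + y)) := by
          have h7 : 0 < (d ^ 3)⁻¹ * x := by positivity
          have h8 : 0 < (d ^ 3)⁻¹ * y := by positivity
          have h9 : (2 : ℝ) * 2 ^ (m + 3) * ((d ^ 3)⁻¹ * (x + y)) =
            2 ^ m * (16 * ((d ^ 3)⁻¹ * x) + 16 * ((d ^ 3)⁻¹ * y)) := by rw [pow_add]; ring
          rw [h9]
          gcongr 2 ^ m * ?_
          linarith
  -- replacing the degrees
  set Ph : Matrix (Fin n) (Fin n) ℝ := Matrix.of fun i' j' : Fin n => H i' j' / ∑ l, H i' l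
  have hxd : x / d ≤ 1 / 4 := by
    rw [hx, div_div, div_le_iff₀ (by positivity)]; linarith
  have hscale : ∀ i, |g * D i / ∑ l, H i l - 1| ≤ 2 * (x / d) := fun i => by
    have h1 := hHpos i
    have h2 : g * D i / ∑ l, H i l - 1 = (g * D i - ∑ l, H i l) / ∑ l, H i l := by field_simp
    have h3 : τ * s = x / d * (g * (N * d)) := by
      have : N = s ^ 2 / g := by rw [hs2]; field_simp
      rw [hx, this]; field_simp
    have h4 : 0 < x / d := by positivity
    rw [h2, abs_div, abs_of_pos h1, div_le_iff₀ h1, abs_sub_comm]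
    refine (hdeg' i).trans ?_
    rw [h3]
    nlinarith [hHlow i, hgD i, hgDp i]
  have hPh : ∀ i j, Ph i j = (g * D i / ∑ l, H i l) * Q i j := fun i j => by
    have h1 := hHpos i
    have h2 := hDp i
    change H i j / ∑ l, H i l = _
    rw [hQij]; field_simp
  have hPhQ := abs_pow_sub_pow_le_of_row_scaling hQ0 hscale hPh (m + 3) i j
  have hε := one_add_pow_sub_one_le (ε := 2 * (x / d)) (by positivity) (by linarith) (m + 3)
  have hPent : N * (P ^ (m + 3)) i j ≤ 1 / d := by
    have hPe : EntBdd (fun _ => 1) P (1 / (N * d)) := fun a b => by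
      rw [abs_of_nonneg (hP0 a b), hPij, mul_one]
      exact div_le_div₀ zero_le_one (hA01 a b).2 hNd (hD a)
    have h1 := ((hPr.pow zero_le_one (m + 2)).mul_entBdd hPe (by positivity)
      fun _ => zero_le_one) i j
    rw [← pow_succ, one_pow, one_mul, mul_one] at h1
    calc N * (P ^ (m + 3)) i j ≤ N * (1 / (N * d)) :=
          mul_le_mul_of_nonneg_left ((le_abs_self _).trans h1) hN.le
      _ = 1 / d := by field_simp
  set η := 2 * 2 ^ (m + 3) * ((d ^ 3)⁻¹ * (x + y)) with hηdef
  have hQent : N * (Q ^ (m + 3)) i j ≤ 1 / d + η := by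
    have := mul_le_mul_of_nonneg_left
      (le_abs_self ((Q ^ (m + 3)) i j - (P ^ (m + 3)) i j)) hN.le
    linarith
  have hη0 : 0 ≤ η := by positivity
  have hfin : N * |(Ph ^ (m + 3)) i j - (Q ^ (m + 3)) i j| ≤
      2 * (x / d) * 2 ^ (m + 3) * (1 / d + η) := by
    calc N * |(Ph ^ (m + 3)) i j - (Q ^ (m + 3)) i j|
        ≤ N * (2 * (x / d) * 2 ^ (m + 3) * (Q ^ (m + 3)) i j) := by
          gcongr
          exact hPhQ.trans (mul_le_mul_of_nonneg_right hε (pow_apply_nonneg hQ0 _ i j))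
      _ = 2 * (x / d) * 2 ^ (m + 3) * (N * (Q ^ (m + 3)) i j) := by ring
      _ ≤ _ := by gcongr
  have htri : N * |(P ^ (m + 3)) i j - (Ph ^ (m + 3)) i j| ≤
      N * |(Q ^ (m + 3)) i j - (P ^ (m + 3)) i j| +
      N * |(Ph ^ (m + 3)) i j - (Q ^ (m + 3)) i j| := by
    rw [← mul_add]
    refine mul_le_mul_of_nonneg_left ?_ hN.le
    rw [abs_sub_comm ((P ^ (m + 3)) i j)]
    exact (abs_sub_le _ _ _).trans_eq (add_comm _ _)
  have h8 : (8 : ℝ) ≤ 2 ^ (m + 3) := by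
    have : (1 : ℝ) ≤ 2 ^ m := one_le_pow₀ one_le_two
    rw [pow_add]; linarith
  have hp4 : (4 : ℝ) ^ (m + 4) = 4 * (2 ^ (m + 3) * 2 ^ (m + 3)) := by
    rw [← mul_pow]; norm_num [pow_succ]; ring
  have ht : (1 / s + 1 / r) * 4 ^ (m + 4) * (d ^ 3)⁻¹ * τ =
      4 * (2 ^ (m + 3) * 2 ^ (m + 3)) * ((d ^ 3)⁻¹ * (x + y)) := by
    rw [hp4, hx, hy]; ring
  rw [ht]
  refine htri.trans ((add_le_add hη hfin).trans ?_)
  set T : ℝ := 2 ^ (m + 3)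
  set z := (d ^ 3)⁻¹ * (x + y)
  have hz : x / d * (1 / d) ≤ z := by
    calc x / d * (1 / d) = (d ^ 2)⁻¹ * x := by field_simp
      _ ≤ (d ^ 3)⁻¹ * (x + y) := by gcongr; linarith
  have hz0 : 0 < z := by positivity
  have hu : x / d * η ≤ 1 / 4 * η := mul_le_mul_of_nonneg_right hxd hη0
  have hT : (0 : ℝ) < T := by linarith
  calc η + 2 * (x / d) * T * (1 / d + η)
      = η + 2 * T * (x / d * (1 / d)) + 2 * T * (x / d * η) := by ring
    _ ≤ η + 2 * T * z + 2 * T * (1 / 4 * η) := by gcongr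
    _ = 4 * T * z + T * T * z := by rw [hηdef]; ring
    _ ≤ 4 * (T * T) * z := by
      have : 0 ≤ (T - 4) * T * z := by
        have : 0 ≤ T - 4 := by linarith
        positivity
      nlinarith [mul_pos (mul_pos hT hT) hz0]

section Concentration

open ProbabilityTheory

variable {ι κ : Type*} [Fintype ι] {ν : ι → Measure Bool} [∀ i, IsProbabilityMeasure (ν i)]

lemma indepFun_of_dependsOn {f g : (ι → Bool) → ℝ} {S T : Set ι} (hf : DependsOn f S)
    (hg : DependsOn g T) (hST : Disjoint S T) : IndepFun f g (Measure.pi ν) := by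
  classical
  have hind : iIndepFun (fun i (ω : ι → Bool) => ω i) (Measure.pi ν) :=
    iIndepFun_pi (X := fun _ => id) fun _ => aemeasurable_id
  have h := hind.indepFun_finset S.toFinset T.toFinset (by simpa using hST)
    fun i => measurable_pi_apply i
  rw [← Set.coe_toFinset S] at hf
  rw [← Set.coe_toFinset T] at hg
  obtain ⟨f', rfl⟩ := dependsOn_iff_exists_comp.1 hf
  obtain ⟨g', rfl⟩ := dependsOn_iff_exists_comp.1 hg
  exact h.comp (φ := f') (ψ := g') Measurable.of_discrete Measurable.of_discrete

lemma integral_mul_of_dependsOn {f g : (ι → Bool) → ℝ} {S T : Set ι} (hf : DependsOn f S)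
    (hg : DependsOn g T) (hST : Disjoint S T) :
    ∫ ω, f ω * g ω ∂(Measure.pi ν) = (∫ ω, f ω ∂(Measure.pi ν)) * ∫ ω, g ω ∂(Measure.pi ν) :=
  (indepFun_of_dependsOn hf hg hST).integral_mul_eq_mul_integral
    Measurable.of_discrete.aestronglyMeasurable Measurable.of_discrete.aestronglyMeasurable

lemma integral_prod_of_dependsOn (s : Finset κ) {S : κ → Set ι}
    (hS : (s : Set κ).PairwiseDisjoint S) {F : κ → (ι → Bool) → ℝ}
    (hF : ∀ a ∈ s, DependsOn (F a) (S a)) :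
    ∫ ω, ∏ a ∈ s, F a ω ∂(Measure.pi ν) = ∏ a ∈ s, ∫ ω, F a ω ∂(Measure.pi ν) := by
  classical
  induction s using Finset.induction_on with
  | empty => simp
  | insert a s ha ih =>
    simp only [Finset.prod_insert ha]
    rw [← ih (hS.subset (by simp)) fun b hb => hF b (Finset.mem_insert_of_mem hb)]
    refine integral_mul_of_dependsOn (hF a (Finset.mem_insert_self a s))
      (T := ⋃ b ∈ s, S b) ?_ ?_
    · intro x y hxy
      refine Finset.prod_congr rfl fun b hb => hF b (Finset.mem_insert_of_mem hb) fun i hi => ?_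
      exact hxy i (Set.mem_biUnion hb hi)
    · simp only [Set.disjoint_iUnion_right]
      intro b hb
      refine hS (by simp) (by simp [hb]) ?_
      rintro rfl
      exact ha hb

/-- One-sided exponential tail bound for a sum of centered bounded variables which depend on
disjoint sets of coordinates of a product measure. -/
lemma measureReal_sum_ge_le (s : Finset κ) {S : κ → Set ι}
    (hS : (s : Set κ).PairwiseDisjoint S) {X : κ → (ι → Bool) → ℝ}
    (hX : ∀ a ∈ s, DependsOn (X a) (S a)) (hmean : ∀ a ∈ s, ∫ ω, X a ω ∂(Measure.pi ν) = 0)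
    {v σ : ℝ} (hvar : ∀ a ∈ s, ∫ ω, X a ω ^ 2 ∂(Measure.pi ν) ≤ v)
    (hbd : ∀ a ∈ s, ∀ ω, |X a ω| ≤ 1) (hσ : 1 ≤ σ) (hv : s.card * v ≤ σ ^ 2) (τ : ℝ) :
    (Measure.pi ν).real {ω | τ * σ ≤ ∑ a ∈ s, X a ω} ≤ Real.exp (1 - τ) := by
  have hσ0 : 0 < σ := by linarith
  have hmgf : ∀ a ∈ s, ∫ ω, Real.exp (σ⁻¹ * X a ω) ∂(Measure.pi ν) ≤ Real.exp (v / σ ^ 2) := by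
    intro a ha
    have hle : ∀ ω, Real.exp (σ⁻¹ * X a ω) ≤ 1 + σ⁻¹ * X a ω + (σ⁻¹) ^ 2 * X a ω ^ 2 := by
      intro ω
      have h1 : |σ⁻¹ * X a ω| ≤ 1 := by
        rw [abs_mul, abs_of_pos (by positivity)]
        exact mul_le_one₀ (inv_le_one_of_one_le₀ hσ) (abs_nonneg _) (hbd a ha ω)
      have h2 := (abs_le.1 (Real.abs_exp_sub_one_sub_id_le h1)).2
      rw [mul_pow] at h2
      linarith
    calc ∫ ω, Real.exp (σ⁻¹ * X a ω) ∂(Measure.pi ν)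
        ≤ ∫ ω, (1 + σ⁻¹ * X a ω + (σ⁻¹) ^ 2 * X a ω ^ 2) ∂(Measure.pi ν) :=
          integral_mono Integrable.of_finite Integrable.of_finite hle
      _ = 1 + (σ⁻¹) ^ 2 * ∫ ω, X a ω ^ 2 ∂(Measure.pi ν) := by
          rw [integral_add Integrable.of_finite Integrable.of_finite,
            integral_add Integrable.of_finite Integrable.of_finite, integral_const_mul,
            integral_const_mul, hmean a ha]
          simp
      _ ≤ 1 + v / σ ^ 2 := by
          have := mul_le_mul_of_nonneg_left (hvar a ha) (sq_nonneg σ⁻¹)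
          rw [inv_pow] at this ⊢
          rw [div_eq_inv_mul]
          linarith
      _ ≤ Real.exp (v / σ ^ 2) := by linarith [Real.add_one_le_exp (v / σ ^ 2)]
  have hch := measure_ge_le_exp_mul_mgf (μ := Measure.pi ν) (X := fun ω => ∑ a ∈ s, X a ω)
    (t := σ⁻¹) (τ * σ) (by positivity) Integrable.of_finite
  refine hch.trans ?_
  have h1 : mgf (fun ω => ∑ a ∈ s, X a ω) (Measure.pi ν) σ⁻¹ =
      ∏ a ∈ s, ∫ ω, Real.exp (σ⁻¹ * X a ω) ∂(Measure.pi ν) := by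
    rw [mgf, ← integral_prod_of_dependsOn s hS]
    · simp only [Finset.mul_sum, Real.exp_sum]
    · intro a ha x y hxy
      simp only [hX a ha hxy]
  have h2 : ∏ a ∈ s, ∫ ω, Real.exp (σ⁻¹ * X a ω) ∂(Measure.pi ν) ≤ Real.exp 1 := by
    calc ∏ a ∈ s, ∫ ω, Real.exp (σ⁻¹ * X a ω) ∂(Measure.pi ν)
        ≤ ∏ _a ∈ s, Real.exp (v / σ ^ 2) :=
          Finset.prod_le_prod (fun a _ => integral_nonneg fun ω => (Real.exp_pos _).le) hmgf
      _ = Real.exp (s.card * (v / σ ^ 2)) := by rw [Finset.prod_const, ← Real.exp_nat_mul]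
      _ ≤ Real.exp 1 := by
          rw [Real.exp_le_exp, ← mul_div_assoc, div_le_one (by positivity)]
          exact hv
  rw [h1]
  calc Real.exp (-σ⁻¹ * (τ * σ)) * ∏ a ∈ s, ∫ ω, Real.exp (σ⁻¹ * X a ω) ∂(Measure.pi ν)
      ≤ Real.exp (-σ⁻¹ * (τ * σ)) * Real.exp 1 := by gcongr
    _ = Real.exp (1 - τ) := by
      rw [← Real.exp_add]; congr 1; field_simp; ring

/-- Two-sided version of `measureReal_sum_ge_le`. -/
lemma measureReal_abs_sum_gt_le (s : Finset κ) {S : κ → Set ι}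
    (hS : (s : Set κ).PairwiseDisjoint S) {X : κ → (ι → Bool) → ℝ}
    (hX : ∀ a ∈ s, DependsOn (X a) (S a)) (hmean : ∀ a ∈ s, ∫ ω, X a ω ∂(Measure.pi ν) = 0)
    {v σ : ℝ} (hvar : ∀ a ∈ s, ∫ ω, X a ω ^ 2 ∂(Measure.pi ν) ≤ v)
    (hbd : ∀ a ∈ s, ∀ ω, |X a ω| ≤ 1) (hσ : 1 ≤ σ) (hv : s.card * v ≤ σ ^ 2) (τ : ℝ) :
    (Measure.pi ν).real {ω | τ * σ < |∑ a ∈ s, X a ω|} ≤ 2 * Real.exp (1 - τ) := by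
  have h1 := measureReal_sum_ge_le s hS hX hmean hvar hbd hσ hv τ
  have h2 := measureReal_sum_ge_le (ν := ν) (X := fun a ω => -X a ω) s hS
    (fun a ha x y hxy => by simp only [hX a ha hxy])
    (fun a ha => by rw [integral_neg, hmean a ha, neg_zero])
    (fun a ha => by simpa using hvar a ha) (fun a ha ω => by simpa using hbd a ha ω) hσ hv τ
  have h3 : {ω | τ * σ < |∑ a ∈ s, X a ω|} ⊆
      {ω | τ * σ ≤ ∑ a ∈ s, X a ω} ∪ {ω | τ * σ ≤ ∑ a ∈ s, -X a ω} := by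
    intro ω hω
    have hω' : τ * σ < |∑ a ∈ s, X a ω| := hω
    rcases lt_abs.1 hω' with h | h
    · exact Or.inl h.le
    · exact Or.inr (by simpa using h.le)
  calc (Measure.pi ν).real {ω | τ * σ < |∑ a ∈ s, X a ω|} ≤ _ := measureReal_mono h3
    _ ≤ _ := measureReal_union_le _ _
    _ ≤ 2 * Real.exp (1 - τ) := by linarith

end Concentration

lemma isProbabilityMeasure_bern_s18 {p : ℝ} (h0 : 0 ≤ p) (h1 : p ≤ 1) :
    IsProbabilityMeasure (bern p) := by
  constructor
  simp only [bern, Measure.coe_add, Measure.coe_smul, Pi.add_apply, Pi.smul_apply, measure_univ,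
    smul_eq_mul, mul_one]
  rw [← ENNReal.ofReal_add (by linarith) h0]
  simp

lemma integral_bern_s18 {p : ℝ} (h0 : 0 ≤ p) (h1 : p ≤ 1) (f : Bool → ℝ) :
    ∫ b, f b ∂(bern p) = (1 - p) * f false + p * f true := by
  have := isProbabilityMeasure_bern_s18 h0 h1
  rw [integral_fintype Integrable.of_finite]
  simp [bern, Measure.real, h0, h1, add_comm]

section Edges

variable {n : ℕ}

/-- The coordinates of the edge space which carry the edge between `i` and `j`. -/
def edgeCoord (i j : Fin n) : Set {q : Fin n × Fin n // q.1 < q.2} :=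
  {q | q.1 = (i, j) ∨ q.1 = (j, i)}

lemma hatA_isSymm (e : {q : Fin n × Fin n // q.1 < q.2} → Bool) : (hatA e).IsSymm := by
  ext i j
  rcases lt_trichotomy i j with h | h | h
  · simp [hatA, h, h.not_gt]
  · simp [h]
  · simp [hatA, h, h.not_gt]

lemma hatA_mem_Icc (e : {q : Fin n × Fin n // q.1 < q.2} → Bool) (i j : Fin n) :
    hatA e i j ∈ Set.Icc (0 : ℝ) 1 := by
  simp only [hatA, Matrix.of_apply]
  split_ifs <;> simp

lemma hatA_self (e : {q : Fin n × Fin n // q.1 < q.2} → Bool) (i : Fin n) : hatA e i i = 0 := by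
  simp [hatA]

lemma dependsOn_hatA (i j : Fin n) :
    DependsOn (fun e : {q : Fin n × Fin n // q.1 < q.2} → Bool => hatA e i j) (edgeCoord i j) := by
  intro x y h
  simp only [hatA, Matrix.of_apply]
  split_ifs with h1 h2 h3 h4 h5 h6 <;> try rfl
  all_goals first
    | (have := h ⟨(i, j), ‹_›⟩ (Or.inl rfl); simp_all)
    | (have := h ⟨(j, i), ‹_›⟩ (Or.inr rfl); simp_all)

variable {A : Matrix (Fin n) (Fin n) ℝ} {γ : ℝ}

lemma isProbabilityMeasure_bern_edge (hA01 : ∀ i j, A i j ∈ Set.Icc (0 : ℝ) 1) (hγ0 : 0 ≤ γ)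
    (hγ1 : γ ≤ 1) (q : {q : Fin n × Fin n // q.1 < q.2}) :
    IsProbabilityMeasure (bern (γ * A q.1.1 q.1.2)) :=
  isProbabilityMeasure_bern_s18 (mul_nonneg hγ0 (hA01 _ _).1)
    (mul_le_one₀ hγ1 (hA01 _ _).1 (hA01 _ _).2)

lemma integral_edgeMeasure_hatA (hA : A.IsSymm) (hA01 : ∀ i j, A i j ∈ Set.Icc (0 : ℝ) 1)
    (hγ0 : 0 ≤ γ) (hγ1 : γ ≤ 1) {i j : Fin n} (hij : i ≠ j) (f : ℝ → ℝ) :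
    ∫ e, f (hatA e i j) ∂(edgeMeasure A γ) = (1 - γ * A i j) * f 0 + γ * A i j * f 1 := by
  have := isProbabilityMeasure_bern_edge hA01 hγ0 hγ1
  wlog h : i < j generalizing i j
  · have hji := this hij.symm (lt_of_le_of_ne (not_lt.1 h) hij.symm)
    rw [hA.apply i j] at hji
    rw [← hji]
    exact integral_congr_ae (.of_forall fun e => by simp only [(hatA_isSymm e).apply i j])
  · have h1 : ∀ e : {q : Fin n × Fin n // q.1 < q.2} → Bool,
        f (hatA e i j) = (fun b : Bool => f (if b then 1 else 0)) (Function.eval ⟨(i, j), h⟩ e) :=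
      fun e => by simp [hatA, h]
    have h2 := (measurePreserving_eval
      (fun q : {q : Fin n × Fin n // q.1 < q.2} => bern (γ * A q.1.1 q.1.2)) ⟨(i, j), h⟩).map_eq
    have h3 := integral_map (μ := edgeMeasure A γ)
      (φ := Function.eval (⟨(i, j), h⟩ : {q : Fin n × Fin n // q.1 < q.2}))
      (measurable_pi_apply _).aemeasurable (f := fun b : Bool => f (if b then 1 else 0))
      Measurable.of_discrete.aestronglyMeasurable
    rw [edgeMeasure, h2, integral_bern_s18 (mul_nonneg hγ0 (hA01 _ _).1)
      (mul_le_one₀ hγ1 (hA01 _ _).1 (hA01 _ _).2)] at h3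
    rw [edgeMeasure, integral_congr_ae (.of_forall h1), ← h3]
    simp

lemma integral_edge_deviation (hA : A.IsSymm) (hA01 : ∀ i j, A i j ∈ Set.Icc (0 : ℝ) 1)
    (hγ0 : 0 ≤ γ) (hγ1 : γ ≤ 1) {i j : Fin n} (hij : i ≠ j) :
    ∫ e, (hatA e i j - γ * A i j) ∂(edgeMeasure A γ) = 0 := by
  rw [integral_edgeMeasure_hatA hA hA01 hγ0 hγ1 hij fun x => x - γ * A i j]
  ring

lemma integral_edge_deviation_sq_le (hA : A.IsSymm) (hA01 : ∀ i j, A i j ∈ Set.Icc (0 : ℝ) 1)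
    (hγ0 : 0 ≤ γ) (hγ1 : γ ≤ 1) {i j : Fin n} (hij : i ≠ j) :
    ∫ e, (hatA e i j - γ * A i j) ^ 2 ∂(edgeMeasure A γ) ≤ γ := by
  rw [integral_edgeMeasure_hatA hA hA01 hγ0 hγ1 hij fun x => (x - γ * A i j) ^ 2]
  have h0 : 0 ≤ γ * A i j := mul_nonneg hγ0 (hA01 i j).1
  have h1 : γ * A i j ≤ γ := mul_le_of_le_one_right hγ0 (hA01 i j).2
  nlinarith

lemma abs_edge_deviation_le (hA01 : ∀ i j, A i j ∈ Set.Icc (0 : ℝ) 1)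
    (hγ0 : 0 ≤ γ) (hγ1 : γ ≤ 1) (e : {q : Fin n × Fin n // q.1 < q.2} → Bool) (i j : Fin n) :
    |hatA e i j - γ * A i j| ≤ 1 := by
  have h1 := hatA_mem_Icc e i j
  have h2 : 0 ≤ γ * A i j := mul_nonneg hγ0 (hA01 i j).1
  have h3 : γ * A i j ≤ 1 := mul_le_one₀ hγ1 (hA01 i j).1 (hA01 i j).2
  rw [abs_le]
  constructor <;> linarith [h1.1, h1.2]

lemma dependsOn_edge_deviation (i j : Fin n) :
    DependsOn (fun e : {q : Fin n × Fin n // q.1 < q.2} → Bool => hatA e i j - γ * A i j)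
      (edgeCoord i j) :=
  fun x y h => by simp only [dependsOn_hatA i j h]

lemma disjoint_edgeCoord {i j k l : Fin n} (h1 : ¬(i = k ∧ j = l)) (h2 : ¬(i = l ∧ j = k)) :
    Disjoint (edgeCoord i j) (edgeCoord k l) := by
  rw [Set.disjoint_left]
  rintro ⟨⟨a, b⟩, hab⟩ h3 h4
  simp only [edgeCoord, Set.mem_ofPred_eq, Prod.mk.injEq] at h3 h4
  grind

/-- Tail bound for a weighted sum of the deviations in one row. -/
lemma edgeMeasure_row_tail (hA : A.IsSymm) (hA01 : ∀ i j, A i j ∈ Set.Icc (0 : ℝ) 1)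
    (hA0 : ∀ i, A i i = 0) (hγ0 : 0 ≤ γ) (hγ1 : γ ≤ 1) (i : Fin n) {w : Fin n → ℝ}
    (hw : ∀ a, |w a| ≤ 1) {σ : ℝ} (hσ : 1 ≤ σ) (hv : n * γ ≤ σ ^ 2) (τ : ℝ) :
    (edgeMeasure A γ).real {e | τ * σ < |∑ a, (hatA e i a - γ * A i a) * w a|} ≤
      2 * Real.exp (1 - τ) := by
  have := isProbabilityMeasure_bern_edge hA01 hγ0 hγ1
  have hsum : ∀ e, ∑ a, (hatA e i a - γ * A i a) * w a =
      ∑ a ∈ Finset.univ.erase i, (hatA e i a - γ * A i a) * w a := fun e => by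
    rw [← Finset.add_sum_erase _ _ (Finset.mem_univ i), hatA_self, hA0]
    simp
  simp only [hsum]
  refine measureReal_abs_sum_gt_le (S := fun a => edgeCoord i a) (v := γ) _ ?_ ?_ ?_ ?_ ?_ hσ ?_ τ
  · intro a ha b hb hab
    exact disjoint_edgeCoord (by grind) (by grind)
  · intro a _ x y h
    simp only [dependsOn_hatA i a h]
  · intro a ha
    rw [integral_mul_const]
    have := integral_edge_deviation hA hA01 hγ0 hγ1 (Finset.ne_of_mem_erase ha).symm
    rw [edgeMeasure] at this
    rw [this, zero_mul]
  · intro a ha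
    have h1 := integral_edge_deviation_sq_le hA hA01 hγ0 hγ1 (Finset.ne_of_mem_erase ha).symm
    rw [edgeMeasure] at h1
    simp only [mul_pow]
    rw [integral_mul_const]
    exact (mul_le_of_le_one_right (integral_nonneg fun e => sq_nonneg _)
      ((sq_le_one_iff_abs_le_one _).2 (hw a))).trans h1
  · intro a _ e
    rw [abs_mul]
    exact mul_le_one₀ (abs_edge_deviation_le hA01 hγ0 hγ1 e i a) (abs_nonneg _) (hw a)
  · refine le_trans ?_ hv
    gcongr
    exact (Finset.card_le_univ _).trans_eq (Fintype.card_fin n)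

/-- Tail bound for an off-diagonal entry of the weighted square of the deviation matrix. -/
lemma edgeMeasure_square_tail (hA : A.IsSymm) (hA01 : ∀ i j, A i j ∈ Set.Icc (0 : ℝ) 1)
    (hA0 : ∀ i, A i i = 0) (hγ0 : 0 ≤ γ) (hγ1 : γ ≤ 1) {i j : Fin n} (hij : i ≠ j)
    {w : Fin n → ℝ} (hw : ∀ a, |w a| ≤ 1) {σ : ℝ} (hσ : 1 ≤ σ) (hv : n * γ ^ 2 ≤ σ ^ 2) (τ : ℝ) :
    (edgeMeasure A γ).real {e | τ * σ <
      |∑ a, (hatA e i a - γ * A i a) * (hatA e a j - γ * A a j) * w a|} ≤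
      2 * Real.exp (1 - τ) := by
  have := isProbabilityMeasure_bern_edge hA01 hγ0 hγ1
  set s : Finset (Fin n) := Finset.univ.filter fun a => a ≠ i ∧ a ≠ j with hs
  have hsum : ∀ e, ∑ a, (hatA e i a - γ * A i a) * (hatA e a j - γ * A a j) * w a =
      ∑ a ∈ s, (hatA e i a - γ * A i a) * (hatA e a j - γ * A a j) * w a := fun e => by
    refine (Finset.sum_subset (Finset.subset_univ s) fun a _ ha => ?_).symm
    have : a = i ∨ a = j := by
      simp only [hs, Finset.mem_filter, Finset.mem_univ, true_and] at ha
      tauto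
    rcases this with rfl | rfl
    · simp [hatA_self, hA0]
    · simp [hatA_self, hA0]
  have hmem : ∀ {a}, a ∈ s → a ≠ i ∧ a ≠ j := fun {a} ha => (Finset.mem_filter.1 ha).2
  have hdisj : ∀ {a}, a ∈ s → Disjoint (edgeCoord i a) (edgeCoord a j) := fun {a} ha => by
    have := hmem ha
    exact disjoint_edgeCoord (by grind) (by grind)
  simp only [hsum]
  refine measureReal_abs_sum_gt_le (S := fun a => edgeCoord i a ∪ edgeCoord a j) (v := γ ^ 2)
    _ ?_ ?_ ?_ ?_ ?_ hσ ?_ τ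
  · intro a ha b hb hab
    have h1 := hmem ha
    have h2 := hmem hb
    simp only [Function.onFun, Set.disjoint_union_left, Set.disjoint_union_right]
    exact ⟨⟨disjoint_edgeCoord (by grind) (by grind), disjoint_edgeCoord (by grind) (by grind)⟩,
      disjoint_edgeCoord (by grind) (by grind), disjoint_edgeCoord (by grind) (by grind)⟩
  · intro a _ x y h
    simp only [dependsOn_hatA i a fun q hq => h q (Or.inl hq),
      dependsOn_hatA a j fun q hq => h q (Or.inr hq)]
  · intro a ha
    have h1 := integral_edge_deviation hA hA01 hγ0 hγ1 (hmem ha).1.symm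
    rw [edgeMeasure] at h1
    rw [integral_mul_const, integral_mul_of_dependsOn (dependsOn_edge_deviation i a)
      (dependsOn_edge_deviation a j) (hdisj ha), h1, zero_mul, zero_mul]
  · intro a ha
    have h1 := integral_edge_deviation_sq_le hA hA01 hγ0 hγ1 (hmem ha).1.symm
    have h2 := integral_edge_deviation_sq_le hA hA01 hγ0 hγ1 (hmem ha).2
    rw [edgeMeasure] at h1 h2
    simp only [mul_pow]
    rw [integral_mul_const]
    refine (mul_le_of_le_one_right
      (integral_nonneg fun e => mul_nonneg (sq_nonneg _) (sq_nonneg _))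
      ((sq_le_one_iff_abs_le_one _).2 (hw a))).trans ?_
    rw [integral_mul_of_dependsOn
      (fun x y h => by simp only [dependsOn_hatA i a h])
      (fun x y h => by simp only [dependsOn_hatA a j h]) (hdisj ha), sq γ]
    exact mul_le_mul h1 h2 (integral_nonneg fun e => sq_nonneg _) hγ0
  · intro a _ e
    rw [abs_mul, abs_mul]
    exact mul_le_one₀ (mul_le_one₀ (abs_edge_deviation_le hA01 hγ0 hγ1 e i a) (abs_nonneg _)
      (abs_edge_deviation_le hA01 hγ0 hγ1 e a j)) (abs_nonneg _) (hw a)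
  · refine le_trans ?_ hv
    gcongr
    exact (Finset.card_le_univ _).trans_eq (Fintype.card_fin n)

end Edges

section Main

variable {n : ℕ} {A : Matrix (Fin n) (Fin n) ℝ}

/-- Entries of powers of the transition matrix are at most the reciprocal of a lower bound
on the degrees. -/
lemma abs_mul_transition_pow_le_one {δ : ℝ} (hδ : 0 < δ)
    (hA01 : ∀ i j, A i j ∈ Set.Icc (0 : ℝ) 1) (hD : ∀ i, δ ≤ ∑ l, A i l) {l : ℕ} (hl : 1 ≤ l)
    (a j : Fin n) :
    |δ * ((Matrix.of fun i' j' : Fin n => A i' j' / ∑ l, A i' l) ^ l) a j| ≤ 1 := by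
  set P : Matrix (Fin n) (Fin n) ℝ := Matrix.of fun i' j' : Fin n => A i' j' / ∑ l, A i' l
  have hDpos : ∀ i, 0 < ∑ l, A i l := fun i => hδ.trans_le (hD i)
  have hP0 : ∀ i j, 0 ≤ P i j := fun i j => div_nonneg (hA01 i j).1 (hDpos i).le
  have hrow : RowBdd P 1 := fun i => by
    simp only [abs_of_nonneg (hP0 i _)]
    simp only [P, Matrix.of_apply]
    rw [← Finset.sum_div, div_self (hDpos i).ne']
  have hent : EntBdd (fun _ => 1) P δ⁻¹ := fun i j => by
    rw [abs_of_nonneg (hP0 i j), mul_one, inv_eq_one_div]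
    exact div_le_div₀ zero_le_one (hA01 i j).2 hδ (hD i)
  obtain ⟨q, rfl⟩ := Nat.exists_eq_add_of_le' hl
  have h := (hrow.pow zero_le_one q).mul_entBdd hent (by positivity) (fun _ => zero_le_one) a j
  rw [← pow_succ, one_pow, one_mul, mul_one] at h
  rw [abs_mul, abs_of_pos hδ]
  calc δ * |(P ^ (q + 1)) a j| ≤ δ * δ⁻¹ := by gcongr
    _ = 1 := mul_inv_cancel₀ hδ.ne'

/-- The deviation bounds needed for the comparison of the transition matrices hold off an event
of small probability. -/
lemma exists_deviation_event (hA : A.IsSymm) (hA01 : ∀ i j, A i j ∈ Set.Icc (0 : ℝ) 1)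
    (hA0 : ∀ i, A i i = 0) {γ δ s r : ℝ} (hγ0 : 0 ≤ γ) (hγ1 : γ ≤ 1) (hδ : 0 < δ)
    (hD : ∀ i, δ ≤ ∑ l, A i l) (hs : 1 ≤ s) (hr : 1 ≤ r) (hs2 : n * γ ≤ s ^ 2)
    (hr2 : n * γ ^ 2 ≤ r ^ 2) (m : ℕ) (τ : ℝ) :
    ∃ B : Set ({q : Fin n × Fin n // q.1 < q.2} → Bool),
      (edgeMeasure A γ).real B ≤ (n + (m + 1) * n ^ 2) * (2 * Real.exp (1 - τ)) ∧
      ∀ e ∉ B, (∀ i, |∑ l, (hatA e i l - γ * A i l)| ≤ τ * s) ∧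
        (∀ l i j, 1 ≤ l → l ≤ m → |∑ a, (hatA e i a - γ * A i a) *
          (δ * ((Matrix.of fun i' j' : Fin n => A i' j' / ∑ l, A i' l) ^ l) a j)| ≤ τ * s) ∧
        ∀ i j, i ≠ j → |∑ a, (hatA e i a - γ * A i a) * (hatA e a j - γ * A a j) *
          (δ / ∑ l, A a l)| ≤ τ * r := by
  have := isProbabilityMeasure_bern_edge hA01 hγ0 hγ1
  have hfin : IsFiniteMeasure (edgeMeasure A γ) := by
    unfold edgeMeasure
    infer_instance
  let B₁ : Fin n → Set ({q : Fin n × Fin n // q.1 < q.2} → Bool) := fun i =>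
    {e | τ * s < |∑ a, (hatA e i a - γ * A i a) * (1 : ℝ)|}
  let B₂ : Fin m × Fin n × Fin n → Set ({q : Fin n × Fin n // q.1 < q.2} → Bool) := fun x =>
    {e | τ * s < |∑ a, (hatA e x.2.1 a - γ * A x.2.1 a) *
      (δ * ((Matrix.of fun i' j' : Fin n => A i' j' / ∑ l, A i' l) ^ (x.1.val + 1)) a x.2.2)|}
  let B₃ : Fin n × Fin n → Set ({q : Fin n × Fin n // q.1 < q.2} → Bool) := fun x =>
    {e | x.1 ≠ x.2 ∧ τ * r < |∑ a, (hatA e x.1 a - γ * A x.1 a) *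
      (hatA e a x.2 - γ * A a x.2) * (δ / ∑ l, A a l)|}
  have h₁ : ∀ i, (edgeMeasure A γ).real (B₁ i) ≤ 2 * Real.exp (1 - τ) := fun i =>
    edgeMeasure_row_tail hA hA01 hA0 hγ0 hγ1 i (w := fun _ => 1) (by simp) hs hs2 τ
  have h₂ : ∀ x, (edgeMeasure A γ).real (B₂ x) ≤ 2 * Real.exp (1 - τ) := fun x =>
    edgeMeasure_row_tail hA hA01 hA0 hγ0 hγ1 x.2.1
      (fun a => abs_mul_transition_pow_le_one hδ hA01 hD (by omega) a x.2.2) hs hs2 τ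
  have h₃ : ∀ x, (edgeMeasure A γ).real (B₃ x) ≤ 2 * Real.exp (1 - τ) := fun x => by
    by_cases hx : x.1 = x.2
    · simp [B₃, hx, Real.exp_nonneg]
    · refine (measureReal_mono fun e he => he.2).trans
        (edgeMeasure_square_tail hA hA01 hA0 hγ0 hγ1 hx (fun a => ?_) hr hr2 τ)
      have hpos : 0 < ∑ l, A a l := hδ.trans_le (hD a)
      rw [abs_of_nonneg (by positivity)]
      exact (div_le_one hpos).2 (hD a)
  refine ⟨(⋃ i, B₁ i) ∪ ((⋃ x, B₂ x) ∪ ⋃ x, B₃ x), ?_, fun e he => ?_⟩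
  · have h₁' := (measureReal_iUnion_fintype_le (μ := edgeMeasure A γ) B₁).trans
      (Finset.sum_le_sum fun i _ => h₁ i)
    have h₂' := (measureReal_iUnion_fintype_le (μ := edgeMeasure A γ) B₂).trans
      (Finset.sum_le_sum fun i _ => h₂ i)
    have h₃' := (measureReal_iUnion_fintype_le (μ := edgeMeasure A γ) B₃).trans
      (Finset.sum_le_sum fun i _ => h₃ i)
    simp only [Finset.sum_const, Finset.card_univ, Fintype.card_prod, Fintype.card_fin,
      nsmul_eq_mul, Nat.cast_mul] at h₁' h₂' h₃'
    have h₄ := measureReal_union_le (μ := edgeMeasure A γ) (⋃ i, B₁ i) ((⋃ x, B₂ x) ∪ ⋃ x, B₃ x)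
    have h₅ := measureReal_union_le (μ := edgeMeasure A γ) (⋃ x, B₂ x) (⋃ x, B₃ x)
    linarith
  · simp only [Set.mem_union, Set.mem_iUnion, not_or, not_exists] at he
    obtain ⟨he₁, he₂, he₃⟩ := he
    refine ⟨fun i => ?_, fun l i j hl hlm => ?_, fun i j hij => ?_⟩
    · simpa [B₁] using he₁ i
    · obtain ⟨q, rfl⟩ := Nat.exists_eq_add_of_le' hl
      exact not_lt.1 (he₂ (⟨q, hlm⟩, i, j))
    · exact not_lt.1 fun h => he₃ (i, j) ⟨hij, h⟩

end Main

/-- Convergence of powers of random-walk transition matrices under sparse edge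
subsampling: there is an absolute constant `c > 0` such that, with probability at least
`1 − c·k·n²·e^{−τ²/(1+τ)}`, the subsampled degree matrix is invertible and
`max_{i,j} n·|[P^k]_{ij} − [P̂^k]_{ij}| ≤ (n^{−α/2} + n^{1/2−α})·4^{k+1}·d^{−(k+1)}·(1+τ)·τ`. -/
theorem stmt18 :
    ∃ c : ℝ, 0 < c ∧
      ∀ (n k : ℕ), 2 ≤ n → 3 ≤ k → (k : ℝ) ≤ Real.sqrt n →
      ∀ (α γ d τ : ℝ), 1 / 2 < α → α ≤ 1 → γ = (n : ℝ) ^ (α - 1) →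
      0 < d → d ≤ 1 → 0 < τ → τ ≤ d * (n : ℝ) ^ (α / 2) / 4 →
      ∀ (A : Matrix (Fin n) (Fin n) ℝ), A.IsSymm →
      (∀ i j, A i j ∈ Set.Icc (0 : ℝ) 1) → (∀ i, A i i = 0) →
      (∀ i, (n : ℝ) * d ≤ ∑ j, A i j) →
      ENNReal.ofReal (1 - c * k * n ^ 2 * Real.exp (-(τ ^ 2) / (1 + τ))) ≤
        edgeMeasure A γ
          {e | (∀ i, 0 < ∑ j, hatA e i j) ∧
            ∀ i j : Fin n,
              (n : ℝ) *
                |((Matrix.of fun i' j' : Fin n => A i' j' / ∑ l, A i' l) ^ k) i j -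
                  ((Matrix.of fun i' j' : Fin n => hatA e i' j' / ∑ l, hatA e i' l) ^ k) i j| ≤
              ((n : ℝ) ^ (-α / 2) + (n : ℝ) ^ ((1 : ℝ) / 2 - α)) *
                4 ^ (k + 1) * (d ^ (k + 1))⁻¹ * (1 + τ) * τ} := by
  refine ⟨Real.exp 10, Real.exp_pos _, ?_⟩
  intro n k hn hk _ α γ d τ hα hα1 hγ hd hd1 hτ0 hτ A hA hA01 hA0 hD
  have hn1 : (1 : ℝ) ≤ n := by exact_mod_cast (by omega : 1 ≤ n)
  have hn0 : (0 : ℝ) < n := by linarith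
  have hk1 : (1 : ℝ) ≤ k := by exact_mod_cast (by omega : 1 ≤ k)
  have hkn : (1 : ℝ) ≤ k * n ^ 2 := one_le_mul_of_one_le_of_one_le hk1 (one_le_pow₀ hn1)
  rcases le_or_gt (1 - Real.exp 10 * k * n ^ 2 * Real.exp (-(τ ^ 2) / (1 + τ))) 0 with hle | hpos
  · rw [ENNReal.ofReal_of_nonpos hle]
    exact zero_le
  have hτ1 : 1 ≤ τ := by
    by_contra! hlt
    have h1 : 1 ≤ Real.exp 10 * Real.exp (-(τ ^ 2) / (1 + τ)) := by
      rw [← Real.exp_add, Real.one_le_exp_iff, ← neg_le_iff_add_nonneg', le_div_iff₀ (by linarith)]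
      nlinarith
    nlinarith [mul_le_mul hkn h1 zero_le_one (by positivity)]
  have hγ0 : 0 < γ := hγ ▸ Real.rpow_pos_of_pos hn0 _
  have hγ1 : γ ≤ 1 := hγ ▸ Real.rpow_le_one_of_one_le_of_nonpos hn1 (by linarith)
  have hs2 : ((n : ℝ) ^ (α / 2)) ^ 2 = γ * n := by
    rw [hγ, ← Real.rpow_mul_natCast hn0.le, ← Real.rpow_add_one hn0.ne']
    congr 1
    push_cast
    ring
  have hr2 : ((n : ℝ) ^ (α - 1 / 2)) ^ 2 = γ ^ 2 * n := by
    rw [hγ, ← Real.rpow_mul_natCast hn0.le, ← Real.rpow_mul_natCast hn0.le,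
      ← Real.rpow_add_one hn0.ne']
    congr 1
    push_cast
    ring
  have hs1 : 1 ≤ (n : ℝ) ^ (α / 2) := Real.one_le_rpow hn1 (by linarith)
  have hr1 : 1 ≤ (n : ℝ) ^ (α - 1 / 2) := Real.one_le_rpow hn1 (by linarith)
  obtain ⟨m, rfl⟩ := Nat.exists_eq_add_of_le' hk
  obtain ⟨B, hB, hgood⟩ := exists_deviation_event hA hA01 hA0 hγ0.le hγ1 (mul_pos hn0 hd) hD
    hs1 hr1 (by rw [hs2, mul_comm]) (by rw [hr2, mul_comm]) (m + 2) τ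
  have := isProbabilityMeasure_bern_edge hA01 hγ0.le hγ1
  have hprob : IsProbabilityMeasure (edgeMeasure A γ) := by
    unfold edgeMeasure
    infer_instance
  have hBc : 1 - Real.exp 10 * ↑(m + 3) * n ^ 2 * Real.exp (-(τ ^ 2) / (1 + τ)) ≤
      (edgeMeasure A γ).real Bᶜ := by
    rw [probReal_compl_eq_one_sub (Set.toFinite B).measurableSet]
    have hexp : Real.exp (1 - τ) ≤ Real.exp 1 * Real.exp (-(τ ^ 2) / (1 + τ)) := by
      rw [← Real.exp_add, Real.exp_le_exp, sub_eq_add_neg, add_le_add_iff_left,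
        le_div_iff₀ (by linarith)]
      nlinarith
    have hcount : (n + (((m + 2 : ℕ) : ℝ) + 1) * n ^ 2) ≤ 2 * (((m + 3 : ℕ) : ℝ) * n ^ 2) := by
      push_cast
      nlinarith [mul_nonneg (Nat.cast_nonneg (α := ℝ) m) (sq_nonneg (n : ℝ))]
    have hconst : 4 * Real.exp 1 ≤ Real.exp 10 := by
      have h1 := Real.add_one_le_exp (9 : ℝ)
      have h2 : Real.exp 10 = Real.exp 9 * Real.exp 1 := by rw [← Real.exp_add]; norm_num
      nlinarith [Real.exp_pos 1]
    have hfinal : (n + (((m + 2 : ℕ) : ℝ) + 1) * n ^ 2) * (2 * Real.exp (1 - τ)) ≤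
        Real.exp 10 * ↑(m + 3) * n ^ 2 * Real.exp (-(τ ^ 2) / (1 + τ)) :=
      calc (n + (((m + 2 : ℕ) : ℝ) + 1) * n ^ 2) * (2 * Real.exp (1 - τ))
          ≤ 2 * (((m + 3 : ℕ) : ℝ) * n ^ 2) *
            (2 * (Real.exp 1 * Real.exp (-(τ ^ 2) / (1 + τ)))) := by gcongr
        _ = 4 * Real.exp 1 * (((m + 3 : ℕ) : ℝ) * n ^ 2 * Real.exp (-(τ ^ 2) / (1 + τ))) := by
          ring
        _ ≤ Real.exp 10 * (((m + 3 : ℕ) : ℝ) * n ^ 2 * Real.exp (-(τ ^ 2) / (1 + τ))) := by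
          gcongr
        _ = _ := by ring
    linarith
  refine (ENNReal.ofReal_le_ofReal hBc).trans ?_
  rw [ofReal_measureReal]
  refine measure_mono fun e he => ?_
  obtain ⟨hdeg, hpow, hsq⟩ := hgood e he
  obtain ⟨h1, h2⟩ := transition_pow_close hA (hatA_isSymm e) hA01 (hatA_mem_Icc e) hn0 hd hd1
    hγ0 hγ1 (by linarith) hr1 hτ1 hs2 hr2 hτ hD
    (fun i => (Finset.sum_le_sum fun l _ => (hA01 i l).2).trans (by simp)) hdeg hpow hsq
  refine ⟨h1, fun i j => (h2 i j).trans ?_⟩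
  have hs' : 1 / (n : ℝ) ^ (α / 2) = (n : ℝ) ^ (-α / 2) := by
    rw [neg_div, Real.rpow_neg hn0.le, one_div]
  have hr' : 1 / (n : ℝ) ^ (α - 1 / 2) = (n : ℝ) ^ ((1 : ℝ) / 2 - α) := by
    rw [← neg_sub α, Real.rpow_neg hn0.le, one_div]
  rw [hs', hr']
  have hdpow : (d ^ 3)⁻¹ ≤ (d ^ (m + 3 + 1))⁻¹ :=
    inv_anti₀ (by positivity) (pow_le_pow_of_le_one hd.le hd1 (by omega))
  calc ((n : ℝ) ^ (-α / 2) + (n : ℝ) ^ ((1 : ℝ) / 2 - α)) * 4 ^ (m + 4) * (d ^ 3)⁻¹ * τ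
      ≤ ((n : ℝ) ^ (-α / 2) + (n : ℝ) ^ ((1 : ℝ) / 2 - α)) * 4 ^ (m + 3 + 1) *
          (d ^ (m + 3 + 1))⁻¹ * τ := by gcongr
    _ ≤ ((n : ℝ) ^ (-α / 2) + (n : ℝ) ^ ((1 : ℝ) / 2 - α)) * 4 ^ (m + 3 + 1) *
          (d ^ (m + 3 + 1))⁻¹ * (1 + τ) * τ := by
      exact mul_le_mul_of_nonneg_right
        (le_mul_of_one_le_right (by positivity) (by linarith)) hτ0.le
end
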